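/- arXiv:1506.05192 — 6 statements merged into one kernel-verified Lean document; each statement's English description precedes it below -/
import Mathlib

section
/- Let B = {(x,y) ∈ ℝ² : y ≥ 0 and x² + y² ≤ 1} be the closed upper half of the unit disk, and let P(x,y) = (x+iy)² and Q(x,y) = x+iy (complex-valued polynomial functions on ℝ²). Then for every integer m ≥ 1, ∫_B P(x,y)^m dx dy = 0, while ∫_B Q(x,y)·P(x,y)^m dx dy = 2i/((2m+3)(2m+1)), which is nonzero. -/
open MeasureTheory

theorem polarCoord_symm_mem_upperHalfDisk_iff {r θ : ℝ} (hr : 0 < r)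
    (hθ : θ ∈ Set.Ioo (-Real.pi) Real.pi) :
    polarCoord.symm (r, θ) ∈ {p : ℝ × ℝ | 0 ≤ p.2 ∧ p.1 ^ 2 + p.2 ^ 2 ≤ 1} ↔
      r ∈ Set.Iic 1 ∧ θ ∈ Set.Ici 0 := by
  have hsq : (r * Real.cos θ) ^ 2 + (r * Real.sin θ) ^ 2 = r ^ 2 := by
    linear_combination r ^ 2 * Real.cos_sq_add_sin_sq θ
  simp only [polarCoord_symm_apply, Set.mem_ofPred_eq, Set.mem_Iic, Set.mem_Ici, hsq,
    mul_nonneg_iff_of_pos_left hr, sq_le_one_iff₀ hr.le]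
  rw [and_comm]
  refine and_congr_right fun _ =>
    ⟨fun h => ?_, fun h => Real.sin_nonneg_of_nonneg_of_le_pi h hθ.2.le⟩
  by_contra! hneg
  exact (Real.sin_neg_of_neg_of_neg_pi_lt hneg hθ.1).not_ge h

theorem integral_exp_mul_I_zero_pi {n : ℕ} (hn : n ≠ 0) :
    ∫ θ in (0 : ℝ)..Real.pi, Complex.exp (n * Complex.I * θ) =
      ((-1) ^ n - 1) / (n * Complex.I) := by
  have hc : (n * Complex.I : ℂ) ≠ 0 := mul_ne_zero (Nat.cast_ne_zero.2 hn) Complex.I_ne_zero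
  rw [integral_exp_mul_complex hc]
  have h : Complex.exp (n * Complex.I * Real.pi) = (-1) ^ n := by
    rw [← Complex.exp_pi_mul_I, ← Complex.exp_nat_mul]
    ring_nf
  simp [h]

theorem setIntegral_upperHalfDisk_pow {n : ℕ} (hn : n ≠ 0) :
    ∫ p : ℝ × ℝ in {p : ℝ × ℝ | 0 ≤ p.2 ∧ p.1 ^ 2 + p.2 ^ 2 ≤ 1},
        ((p.1 : ℂ) + Complex.I * (p.2 : ℂ)) ^ n =
      1 / (n + 2) * (((-1) ^ n - 1) / (n * Complex.I)) := by
  have hB : MeasurableSet {p : ℝ × ℝ | 0 ≤ p.2 ∧ p.1 ^ 2 + p.2 ^ 2 ≤ 1} := by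
    measurability
  have hpolar : ∀ p ∈ polarCoord.target,
      p.1 • Set.indicator {p : ℝ × ℝ | 0 ≤ p.2 ∧ p.1 ^ 2 + p.2 ^ 2 ≤ 1}
        (fun p : ℝ × ℝ => ((p.1 : ℂ) + Complex.I * (p.2 : ℂ)) ^ n) (polarCoord.symm p) =
      (Set.Iic (1 : ℝ)).indicator (fun r : ℝ => (r : ℂ) ^ (n + 1)) p.1 *
        (Set.Ici (0 : ℝ)).indicator (fun θ : ℝ => Complex.exp (n * Complex.I * θ)) p.2 := by
    rintro ⟨r, θ⟩ ⟨hr, hθ⟩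
    have hmem := polarCoord_symm_mem_upperHalfDisk_iff hr hθ
    simp only [Set.indicator_apply, hmem]
    by_cases h1 : r ∈ Set.Iic (1 : ℝ) <;> by_cases h2 : θ ∈ Set.Ici (0 : ℝ) <;>
      simp only [h1, h2, and_true, and_false, if_true, if_false, smul_zero, mul_zero, zero_mul]
    have hexp : ((r * Real.cos θ : ℝ) : ℂ) + Complex.I * ((r * Real.sin θ : ℝ) : ℂ) =
        r * Complex.exp (θ * Complex.I) := by
      rw [Complex.exp_mul_I]
      push_cast
      ring
    simp only [polarCoord_symm_apply, hexp, mul_pow, ← Complex.exp_nat_mul, Complex.real_smul]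
    ring_nf
  have hr : ∫ r in Set.Ioi (0 : ℝ),
      (Set.Iic (1 : ℝ)).indicator (fun r : ℝ => (r : ℂ) ^ (n + 1)) r =
      1 / (n + 2) := by
    rw [setIntegral_indicator measurableSet_Iic, Set.Ioi_inter_Iic,
      ← intervalIntegral.integral_of_le zero_le_one]
    simp_rw [← Complex.ofReal_pow]
    rw [intervalIntegral.integral_ofReal, integral_pow]
    push_cast
    simp
    ring
  have hθ : ∫ θ in Set.Ioo (-Real.pi) Real.pi,
      (Set.Ici (0 : ℝ)).indicator (fun θ : ℝ => Complex.exp (n * Complex.I * θ)) θ =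
      ((-1) ^ n - 1) / (n * Complex.I) := by
    have hset : Set.Ioo (-Real.pi) Real.pi ∩ Set.Ici 0 = Set.Ico 0 Real.pi := by
      ext θ
      have := Real.pi_pos
      simp only [Set.mem_inter_iff, Set.mem_Ioo, Set.mem_Ici, Set.mem_Ico]
      grind
    rw [setIntegral_indicator measurableSet_Ici, hset, integral_Ico_eq_integral_Ioc,
      ← intervalIntegral.integral_of_le Real.pi_pos.le, integral_exp_mul_I_zero_pi hn]
  rw [← integral_indicator hB, ← integral_comp_polarCoord_symm,
    setIntegral_congr_fun polarCoord.open_target.measurableSet hpolar, polarCoord_target,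
    Measure.volume_eq_prod, setIntegral_prod_mul, hr, hθ]

/-- moments of `(x+iy)^2` over the upper half disk vanish, but the
moments against `x+iy` equal `2i/((2m+3)(2m+1)) ≠ 0`. -/
theorem upper_half_disk_moments (m : ℕ) (hm : 1 ≤ m) :
    (∫ p : ℝ × ℝ in {p : ℝ × ℝ | 0 ≤ p.2 ∧ p.1 ^ 2 + p.2 ^ 2 ≤ 1},
        (((p.1 : ℂ) + Complex.I * (p.2 : ℂ)) ^ 2) ^ m) = 0 ∧
    (∫ p : ℝ × ℝ in {p : ℝ × ℝ | 0 ≤ p.2 ∧ p.1 ^ 2 + p.2 ^ 2 ≤ 1},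
        ((p.1 : ℂ) + Complex.I * (p.2 : ℂ)) *
          (((p.1 : ℂ) + Complex.I * (p.2 : ℂ)) ^ 2) ^ m) =
      2 * Complex.I / ((2 * (m : ℂ) + 3) * (2 * (m : ℂ) + 1)) ∧
    2 * Complex.I / ((2 * (m : ℂ) + 3) * (2 * (m : ℂ) + 1)) ≠ 0 := by
  have h1 : (2 * (m : ℂ) + 1) ≠ 0 := by exact_mod_cast (2 * m).succ_ne_zero
  have h3 : (2 * (m : ℂ) + 3) ≠ 0 := by exact_mod_cast (2 * m + 2).succ_ne_zero
  refine ⟨?_, ?_, div_ne_zero (mul_ne_zero two_ne_zero Complex.I_ne_zero) (mul_ne_zero h3 h1)⟩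
  · simp_rw [← pow_mul]
    rw [setIntegral_upperHalfDisk_pow (by omega)]
    simp
  · simp_rw [← pow_mul, ← pow_succ']
    rw [setIntegral_upperHalfDisk_pow (by omega), Odd.neg_one_pow ⟨m, rfl⟩]
    push_cast
    rw [show (2 * (m : ℂ) + 1 + 2) = 2 * m + 3 by ring]
    field_simp
    rw [Complex.I_sq]
    norm_num
end

section
/- If GMC(n) holds for every n ≥ 1, then JC(n) holds for every n ≥ 1. That is: assume that for every n ≥ 1 and every P ∈ ℂ[x₁,…,xₙ] with E(Pᵐ) = 0 for all m ≥ 1, and every Q ∈ ℂ[x₁,…,xₙ], one has E(Pᵐ·Q) = 0 for all sufficiently large m. Then for every n ≥ 1, every polynomial map F = (F₁,…,Fₙ) : ℂⁿ → ℂⁿ (each Fᵢ ∈ ℂ[x₁,…,xₙ]) whose Jacobian determinant det(∂Fᵢ/∂xⱼ) is a nonzero constant polynomial has a polynomial inverse, i.e., there exist G₁,…,Gₙ ∈ ℂ[x₁,…,xₙ] such that the polynomial map G = (G₁,…,Gₙ) satisfies G∘F = F∘G = id on ℂⁿ. -/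
open MeasureTheory ProbabilityTheory

/-- The Gaussian expectation of a complex polynomial in the variables indexed by `σ`,
with respect to the standard Gaussian measure (product of `N(0,1)`'s). -/
noncomputable def gaussExp {σ : Type*} [Fintype σ] (P : MvPolynomial σ ℂ) : ℂ :=
  ∫ x : σ → ℝ, MvPolynomial.eval (fun i => (x i : ℂ)) P
    ∂(Measure.pi fun _ : σ => gaussianReal 0 1)

/-- The Gaussian Moments Conjecture in `n` variables. -/
def GMC (n : ℕ) : Prop :=
  ∀ P : MvPolynomial (Fin n) ℂ,
    (∀ m : ℕ, 1 ≤ m → gaussExp (P ^ m) = 0) →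
    ∀ Q : MvPolynomial (Fin n) ℂ, ∃ N : ℕ, ∀ m : ℕ, N ≤ m → gaussExp (P ^ m * Q) = 0

/-- The Jacobian Conjecture in `n` variables: every polynomial map `ℂⁿ → ℂⁿ` whose
Jacobian determinant is a nonzero constant has a polynomial inverse. -/
def JC (n : ℕ) : Prop :=
  ∀ F : Fin n → MvPolynomial (Fin n) ℂ,
    (∃ c : ℂ, c ≠ 0 ∧
      (Matrix.det fun i j => MvPolynomial.pderiv j (F i)) = MvPolynomial.C c) →
    ∃ G : Fin n → MvPolynomial (Fin n) ℂ,
      (∀ x : Fin n → ℂ,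
        (fun i => MvPolynomial.eval (fun j => MvPolynomial.eval x (F j)) (G i)) = x) ∧
      (∀ x : Fin n → ℂ,
        (fun i => MvPolynomial.eval (fun j => MvPolynomial.eval x (G j)) (F i)) = x)

section GaussianIntegration

lemma integrable_pow_mul_gaussianPDFReal (k : ℕ) :
    Integrable fun x : ℝ => x ^ k * gaussianPDFReal 0 1 x := by
  have h := (integrable_rpow_mul_exp_neg_mul_sq (b := 1 / 2) (by norm_num)
    (s := k) (by have : (0 : ℝ) ≤ k := k.cast_nonneg
                 linarith)).const_mul (√(2 * Real.pi * 1))⁻¹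
  refine h.congr (Filter.Eventually.of_forall fun x => ?_)
  simp only [gaussianPDFReal, Real.rpow_natCast, NNReal.coe_one, sub_zero]
  rw [show -(1 / 2) * x ^ 2 = -x ^ 2 / (2 * 1) by ring]
  ring

lemma integral_pow_succ_gaussianReal (k : ℕ) :
    ∫ x, x ^ (k + 1) ∂(gaussianReal 0 1) = k * ∫ x, x ^ (k - 1) ∂(gaussianReal 0 1) := by
  simp only [integral_gaussianReal_eq_integral_smul one_ne_zero, smul_eq_mul]
  have hd : ∀ x : ℝ, HasDerivAt (fun x => x ^ k * gaussianPDFReal 0 1 x)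
      (k * (x ^ (k - 1) * gaussianPDFReal 0 1 x) - x ^ (k + 1) * gaussianPDFReal 0 1 x) x := by
    intro x
    have h1 : HasDerivAt (gaussianPDFReal 0 1) (-x * gaussianPDFReal 0 1 x) x := by
      have h2 : HasDerivAt (fun x : ℝ => -(x - 0) ^ 2 / (2 * ((1 : NNReal) : ℝ))) (-x) x := by
        have := (((hasDerivAt_id x).sub_const 0).pow 2).neg.div_const (2 * ((1 : NNReal) : ℝ))
        convert! this using 1
        simp
        ring
      have h3 := h2.exp.const_mul (√(2 * Real.pi * ((1 : NNReal) : ℝ)))⁻¹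
      convert! h3 using 1
      rw [gaussianPDFReal_def]
      ring
    convert! (hasDerivAt_pow k x).mul h1 using 1
    ring
  have hi := ((integrable_pow_mul_gaussianPDFReal (k - 1)).const_mul (k : ℝ))
  have h0 := integral_eq_zero_of_hasDerivAt_of_integrable hd
    (hi.sub (integrable_pow_mul_gaussianPDFReal (k + 1)))
    (integrable_pow_mul_gaussianPDFReal k)
  rw [integral_sub hi (integrable_pow_mul_gaussianPDFReal (k + 1)), integral_const_mul] at h0
  simp only [mul_comm (gaussianPDFReal 0 1 _)]
  linarith

lemma integral_ofReal_pow_succ_gaussianReal (k : ℕ) :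
    ∫ x : ℝ, (x : ℂ) ^ (k + 1) ∂(gaussianReal 0 1)
      = k * ∫ x : ℝ, (x : ℂ) ^ (k - 1) ∂(gaussianReal 0 1) := by
  have h (j : ℕ) : ∫ x : ℝ, (x : ℂ) ^ j ∂(gaussianReal 0 1)
      = ((∫ x : ℝ, x ^ j ∂(gaussianReal 0 1) : ℝ) : ℂ) := by
    rw [← integral_complex_ofReal]
    simp
  rw [h, h, integral_pow_succ_gaussianReal]
  push_cast
  rfl

lemma integrable_ofReal_pow_gaussianReal (k : ℕ) :
    Integrable (fun x : ℝ => (x : ℂ) ^ k) (gaussianReal 0 1) := by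
  have h : Integrable (fun x : ℝ => x ^ k) (gaussianReal 0 1) := by
    rcases Nat.eq_zero_or_pos k with rfl | hk
    · simp
    · simpa using (memLp_id_gaussianReal (μ := 0) (v := 1) k).integrable_norm_pow hk.ne' |>.mono'
        (f := fun x : ℝ => x ^ k) (by fun_prop) (Filter.Eventually.of_forall fun x => by simp)
  simpa using h.ofReal (𝕜 := ℂ)

variable {σ : Type*} [Fintype σ]

lemma integrable_eval_gaussian (p : MvPolynomial σ ℂ) :
    Integrable (fun x : σ → ℝ => MvPolynomial.eval (fun i => (x i : ℂ)) p)
      (Measure.pi fun _ : σ => gaussianReal 0 1) := by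
  induction p using MvPolynomial.induction_on' with
  | monomial u a =>
    simp only [MvPolynomial.eval_monomial, Finsupp.prod_pow]
    exact (Integrable.fintype_prod (f := fun i (x : ℝ) => (x : ℂ) ^ u i)
      fun i => integrable_ofReal_pow_gaussianReal (u i)).const_mul a
  | add p q hp hq =>
    simp only [map_add]
    exact hp.add hq

/-- Gaussian expectation as a linear functional. -/
noncomputable def gaussExpLin (σ : Type*) [Fintype σ] : MvPolynomial σ ℂ →ₗ[ℂ] ℂ where
  toFun := gaussExp
  map_add' p q := by
    simp only [gaussExp, map_add]
    exact integral_add (integrable_eval_gaussian p) (integrable_eval_gaussian q)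
  map_smul' c p := by
    simp only [gaussExp, MvPolynomial.smul_eval, RingHom.id_apply, smul_eq_mul]
    exact integral_const_mul c _

lemma gaussExpLin_apply (p : MvPolynomial σ ℂ) : gaussExpLin σ p = gaussExp p := rfl

lemma gaussExpLin_monomial (u : σ →₀ ℕ) (a : ℂ) :
    gaussExpLin σ (MvPolynomial.monomial u a)
      = a * ∏ i, ∫ x : ℝ, (x : ℂ) ^ u i ∂(gaussianReal 0 1) := by
  simp only [gaussExpLin_apply, gaussExp, MvPolynomial.eval_monomial, Finsupp.prod_pow]
  rw [integral_const_mul,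
    integral_fintype_prod_eq_prod (fun i (x : ℝ) => (x : ℂ) ^ u i)]

lemma gaussExpLin_one : gaussExpLin σ 1 = 1 := by
  simp [gaussExpLin_apply, gaussExp]

lemma gaussExpLin_X_mul (i : σ) (p : MvPolynomial σ ℂ) :
    gaussExpLin σ (MvPolynomial.X i * p) = gaussExpLin σ (MvPolynomial.pderiv i p) := by
  classical
  induction p using MvPolynomial.induction_on' with
  | monomial u a =>
    rw [mul_comm, MvPolynomial.X, MvPolynomial.monomial_mul, MvPolynomial.pderiv_monomial,
      gaussExpLin_monomial, gaussExpLin_monomial, ← Finset.mul_prod_erase _ _ (Finset.mem_univ i),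
      ← Finset.mul_prod_erase _ _ (Finset.mem_univ i)]
    have h : ∀ j ∈ Finset.univ.erase i,
        ∫ x : ℝ, (x : ℂ) ^ (u + Finsupp.single i 1 : σ →₀ ℕ) j ∂(gaussianReal 0 1)
        = ∫ x : ℝ, (x : ℂ) ^ (u - Finsupp.single i 1 : σ →₀ ℕ) j ∂(gaussianReal 0 1) := by
      intro j hj
      have hji : i ≠ j := (Finset.ne_of_mem_erase hj).symm
      simp [hji]
    rw [Finset.prod_congr rfl h]
    simp only [Finsupp.add_apply, Finsupp.tsub_apply, Finsupp.single_eq_same]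
    rw [integral_ofReal_pow_succ_gaussianReal]
    ring
  | add p q hp hq => rw [mul_add, map_add, map_add, map_add, hp, hq]

lemma gaussExp_rename {τ : Type*} [Fintype τ] (e : σ ≃ τ) (p : MvPolynomial σ ℂ) :
    gaussExp (MvPolynomial.rename e p) = gaussExp p := by
  simp only [← gaussExpLin_apply]
  induction p using MvPolynomial.induction_on' with
  | monomial u a =>
    rw [MvPolynomial.rename_monomial, gaussExpLin_monomial, gaussExpLin_monomial]
    congr 1
    refine (Fintype.prod_equiv e _ _ fun i => ?_).symm
    rw [Finsupp.mapDomain_apply e.injective]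
  | add p q hp hq => rw [map_add, map_add, map_add, hp, hq]

/-- The Gaussian Moments Conjecture with variables in an arbitrary nonempty finite type. -/
lemma gmc_fintype (h : ∀ n : ℕ, 1 ≤ n → GMC n) [Nonempty σ] (P : MvPolynomial σ ℂ)
    (hP : ∀ m : ℕ, 1 ≤ m → gaussExp (P ^ m) = 0) (Q : MvPolynomial σ ℂ) :
    ∃ N : ℕ, ∀ m : ℕ, N ≤ m → gaussExp (P ^ m * Q) = 0 := by
  let e := Fintype.equivFin σ
  obtain ⟨N, hN⟩ := h (Fintype.card σ) Fintype.card_pos (MvPolynomial.rename e P)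
    (fun m hm => by rw [← map_pow, gaussExp_rename, hP m hm]) (MvPolynomial.rename e Q)
  exact ⟨N, fun m hm => by rw [← gaussExp_rename e, map_mul, map_pow, hN m hm]⟩

end GaussianIntegration

section Derivations

variable {R A : Type*} [CommRing R] [CommRing A] [Algebra R A]

lemma derivation_aeval {σ : Type*} [Fintype σ] (D : Derivation R A A) (g : σ → A)
    (p : MvPolynomial σ R) :
    D (MvPolynomial.aeval g p)
      = ∑ i, MvPolynomial.aeval g (MvPolynomial.pderiv i p) * D (g i) := by
  classical
  induction p using MvPolynomial.induction_on with
  | C a => simp [MvPolynomial.algHom_C]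
  | add p q hp hq => simp only [map_add, hp, hq, add_mul, Finset.sum_add_distrib]
  | mul_X p j hp =>
    simp only [map_mul, MvPolynomial.aeval_X, Derivation.leibniz, hp, smul_eq_mul,
      MvPolynomial.pderiv_X, map_add, add_mul, Finset.sum_add_distrib]
    congr 1
    · simp [Pi.single_apply, apply_ite]
    · rw [Finset.mul_sum]
      exact Finset.sum_congr rfl fun i _ => by ring

lemma pderiv_pderiv_comm {σ : Type*} (i j : σ) (p : MvPolynomial σ R) :
    MvPolynomial.pderiv i (MvPolynomial.pderiv j p)
      = MvPolynomial.pderiv j (MvPolynomial.pderiv i p) := by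
  classical
  induction p using MvPolynomial.induction_on with
  | C a => simp
  | add p q hp hq => simp only [map_add, hp, hq]
  | mul_X p k hp =>
    simp only [Derivation.leibniz, smul_eq_mul, map_add, hp, MvPolynomial.pderiv_X,
      Pi.single_apply]
    split_ifs <;> simp [add_left_comm, add_comm]

lemma derivation_prod {ι : Type*} [DecidableEq ι] (D : Derivation R A A) (s : Finset ι)
    (f : ι → A) : D (∏ i ∈ s, f i) = ∑ i ∈ s, D (f i) * ∏ j ∈ s.erase i, f j := by
  induction s using Finset.induction_on with
  | empty => simp
  | insert a s ha ih =>
    rw [Finset.prod_insert ha, Derivation.leibniz, ih, Finset.sum_insert ha,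
      Finset.erase_insert ha, add_comm, smul_eq_mul, smul_eq_mul, mul_comm, Finset.mul_sum]
    congr 1
    refine Finset.sum_congr rfl fun i hi => ?_
    have hia : a ≠ i := fun h => ha (h ▸ hi)
    rw [Finset.erase_insert_of_ne hia, Finset.prod_insert (fun h => ha (Finset.mem_of_mem_erase h))]
    ring

/-- Jacobi formula for the derivation of a determinant. -/
lemma derivation_det {ι : Type*} [Fintype ι] [DecidableEq ι] (D : Derivation R A A)
    (M : Matrix ι ι A) : D M.det = ∑ j, ∑ i, M.adjugate j i * D (M i j) := by
  have h (j : ι) : ∑ i, M.adjugate j i * D (M i j) = (M.updateCol j fun i => D (M i j)).det := by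
    rw [← Matrix.cramer_apply, Matrix.cramer_eq_adjugate_mulVec]
    rfl
  simp only [h, Matrix.det_apply, map_sum]
  rw [Finset.sum_comm]
  refine Finset.sum_congr rfl fun π _ => ?_
  rw [← Finset.smul_sum, Units.smul_def, Units.smul_def, map_zsmul, derivation_prod]
  congr 1
  refine Finset.sum_congr rfl fun j _ => ?_
  rw [← Finset.mul_prod_erase _ _ (Finset.mem_univ j), Matrix.updateCol_self]
  congr 1
  exact Finset.prod_congr rfl fun i hi => by rw [Matrix.updateCol_ne (Finset.ne_of_mem_erase hi)]

end Derivations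

section WickFunctionals

open MvPolynomial

/-- A linear functional on `ℂ[z, w]` obeying the integration by parts rules of the complex
Gaussian expectation of `Q (z + y, conj z)`. -/
structure IsWick {τ : Type*} (E : MvPolynomial (τ ⊕ τ) ℂ →ₗ[ℂ] ℂ) (y : τ → ℂ) : Prop where
  one : E 1 = 1
  inl_mul : ∀ i Q, E (X (Sum.inl i) * Q) = y i * E Q + E (pderiv (Sum.inr i) Q)
  inr_mul : ∀ i Q, E (X (Sum.inr i) * Q) = E (pderiv (Sum.inl i) Q)

variable {τ : Type*} [Fintype τ]

/-- The substitution `z = (x + i t) / √2 + y`, `w = (x - i t) / √2`. -/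
noncomputable def complexCoords (y : τ → ℂ) :
    MvPolynomial (τ ⊕ τ) ℂ →ₐ[ℂ] MvPolynomial (τ ⊕ τ) ℂ :=
  aeval (Sum.elim
    (fun i => C ((√2 : ℝ) : ℂ)⁻¹ * (X (Sum.inl i) + C Complex.I * X (Sum.inr i)) + C (y i))
    (fun i => C ((√2 : ℝ) : ℂ)⁻¹ * (X (Sum.inl i) - C Complex.I * X (Sum.inr i))))

/-- The complex Gaussian expectation of `Q (z + y, conj z)`. -/
noncomputable def wick (y : τ → ℂ) : MvPolynomial (τ ⊕ τ) ℂ →ₗ[ℂ] ℂ :=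
  gaussExpLin (τ ⊕ τ) ∘ₗ (complexCoords y).toLinearMap

lemma wick_apply (y : τ → ℂ) (Q : MvPolynomial (τ ⊕ τ) ℂ) :
    wick y Q = gaussExpLin (τ ⊕ τ) (complexCoords y Q) := rfl

lemma inv_sqrt_two_sq : (((√2 : ℝ) : ℂ)⁻¹) * (((√2 : ℝ) : ℂ)⁻¹) = 1 / 2 := by
  rw [← mul_inv, ← Complex.ofReal_mul, Real.mul_self_sqrt (by norm_num)]
  norm_num

lemma pderiv_inl_complexCoords (y : τ → ℂ) (i : τ) (Q : MvPolynomial (τ ⊕ τ) ℂ) :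
    pderiv (Sum.inl i) (complexCoords y Q) = ((√2 : ℝ) : ℂ)⁻¹ •
      (complexCoords y (pderiv (Sum.inl i) Q) + complexCoords y (pderiv (Sum.inr i) Q)) := by
  classical
  rw [complexCoords, derivation_aeval, Fintype.sum_sum_type]
  simp [pderiv_X, Pi.single_apply, smul_eq_C_mul]
  ring

lemma pderiv_inr_complexCoords (y : τ → ℂ) (i : τ) (Q : MvPolynomial (τ ⊕ τ) ℂ) :
    pderiv (Sum.inr i) (complexCoords y Q) = (((√2 : ℝ) : ℂ)⁻¹ * Complex.I) •
      (complexCoords y (pderiv (Sum.inl i) Q) - complexCoords y (pderiv (Sum.inr i) Q)) := by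
  classical
  rw [complexCoords, derivation_aeval, Fintype.sum_sum_type]
  simp [pderiv_X, Pi.single_apply, smul_eq_C_mul]
  ring

lemma isWick_wick (y : τ → ℂ) : IsWick (wick y) y where
  one := by rw [wick_apply, map_one, gaussExpLin_one]
  inl_mul i Q := by
    have h : complexCoords y (X (Sum.inl i) * Q)
        = ((√2 : ℝ) : ℂ)⁻¹ • (X (Sum.inl i) * complexCoords y Q)
          + (((√2 : ℝ) : ℂ)⁻¹ * Complex.I) • (X (Sum.inr i) * complexCoords y Q)
          + y i • complexCoords y Q := by
      rw [map_mul]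
      conv_lhs => rw [complexCoords, aeval_X, ← complexCoords]
      simp only [Sum.elim_inl, smul_eq_C_mul, map_mul]
      ring
    simp only [wick_apply, h, map_add, map_sub, map_smul, gaussExpLin_X_mul,
      pderiv_inl_complexCoords, pderiv_inr_complexCoords, smul_eq_mul]
    linear_combination (2 * gaussExpLin (τ ⊕ τ) (complexCoords y (pderiv (Sum.inr i) Q)))
      * inv_sqrt_two_sq + (((√2 : ℝ) : ℂ)⁻¹ * ((√2 : ℝ) : ℂ)⁻¹) *
        (gaussExpLin (τ ⊕ τ) (complexCoords y (pderiv (Sum.inl i) Q)) -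
          gaussExpLin (τ ⊕ τ) (complexCoords y (pderiv (Sum.inr i) Q))) * Complex.I_sq
  inr_mul i Q := by
    have h : complexCoords y (X (Sum.inr i) * Q)
        = ((√2 : ℝ) : ℂ)⁻¹ • (X (Sum.inl i) * complexCoords y Q)
          - (((√2 : ℝ) : ℂ)⁻¹ * Complex.I) • (X (Sum.inr i) * complexCoords y Q) := by
      rw [map_mul]
      conv_lhs => rw [complexCoords, aeval_X, ← complexCoords]
      simp only [Sum.elim_inr, smul_eq_C_mul, map_mul]
      ring
    simp only [wick_apply, h, map_add, map_sub, map_smul, gaussExpLin_X_mul,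
      pderiv_inl_complexCoords, pderiv_inr_complexCoords, smul_eq_mul]
    linear_combination (2 * gaussExpLin (τ ⊕ τ) (complexCoords y (pderiv (Sum.inl i) Q)))
      * inv_sqrt_two_sq - (((√2 : ℝ) : ℂ)⁻¹ * ((√2 : ℝ) : ℂ)⁻¹) *
        (gaussExpLin (τ ⊕ τ) (complexCoords y (pderiv (Sum.inl i) Q)) -
          gaussExpLin (τ ⊕ τ) (complexCoords y (pderiv (Sum.inr i) Q))) * Complex.I_sq

/-- The complex Gaussian expectation depends polynomially on the shift. -/
lemma exists_eval_eq_wick (Q : MvPolynomial (τ ⊕ τ) ℂ) :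
    ∃ q : MvPolynomial τ ℂ, ∀ y, wick y Q = eval y q := by
  suffices h : ∀ S : MvPolynomial (τ ⊕ τ) ℂ, ∃ q : MvPolynomial τ ℂ,
      ∀ y, gaussExpLin (τ ⊕ τ) (complexCoords y Q * S) = eval y q by
    simpa [wick_apply] using h 1
  induction Q using MvPolynomial.induction_on with
  | C a => exact fun S => ⟨C (a * gaussExpLin (τ ⊕ τ) S), fun y => by
      rw [algHom_C, ← Algebra.smul_def, map_smul, eval_C, smul_eq_mul]⟩
  | add p q hp hq =>
    intro S
    obtain ⟨a, ha⟩ := hp S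
    obtain ⟨b, hb⟩ := hq S
    exact ⟨a + b, fun y => by rw [map_add, add_mul, map_add, ha, hb, map_add]⟩
  | mul_X p j hp =>
    intro S
    rcases j with i | i
    · obtain ⟨a, ha⟩ := hp (C ((√2 : ℝ) : ℂ)⁻¹ * (X (Sum.inl i) + C Complex.I * X (Sum.inr i)) * S)
      obtain ⟨b, hb⟩ := hp S
      refine ⟨a + X i * b, fun y => ?_⟩
      have h : complexCoords y (p * X (Sum.inl i)) * S = complexCoords y p *
          (C ((√2 : ℝ) : ℂ)⁻¹ * (X (Sum.inl i) + C Complex.I * X (Sum.inr i)) * S)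
          + y i • (complexCoords y p * S) := by
        rw [map_mul]
        conv_lhs => enter [1, 2]; rw [complexCoords, aeval_X]
        rw [Sum.elim_inl, smul_eq_C_mul]
        ring
      rw [h, map_add, map_smul, ha, hb, map_add, map_mul, eval_X, smul_eq_mul]
    · obtain ⟨a, ha⟩ := hp (C ((√2 : ℝ) : ℂ)⁻¹ * (X (Sum.inl i) - C Complex.I * X (Sum.inr i)) * S)
      refine ⟨a, fun y => ?_⟩
      rw [← ha, map_mul (complexCoords y), mul_assoc]
      conv_lhs => enter [2, 2, 1]; rw [complexCoords, aeval_X]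
      rfl

/-- The Gaussian Moments Conjecture for complex Gaussian variables. -/
lemma gmc_wick (h : ∀ n : ℕ, 1 ≤ n → GMC n) [Nonempty τ] (y : τ → ℂ)
    (P : MvPolynomial (τ ⊕ τ) ℂ) (hP : ∀ m : ℕ, 1 ≤ m → wick y (P ^ m) = 0)
    (Q : MvPolynomial (τ ⊕ τ) ℂ) : ∃ N : ℕ, ∀ m : ℕ, N ≤ m → wick y (P ^ m * Q) = 0 := by
  simp only [wick_apply, map_mul, map_pow] at hP ⊢
  exact gmc_fintype h _ hP _

end WickFunctionals

section Inversion

open MvPolynomial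

variable {σ : Type*}

/-- Polynomials in the holomorphic variables, viewed inside `ℂ[z, w]`. -/
noncomputable abbrev holo : MvPolynomial (Option σ) ℂ →ₐ[ℂ] MvPolynomial (Option σ ⊕ Option σ) ℂ :=
  rename Sum.inl

lemma pderiv_inr_holo (j : Option σ) (f : MvPolynomial (Option σ) ℂ) :
    pderiv (Sum.inr j) (holo f) = 0 := by
  classical
  refine pderiv_eq_zero_of_notMem_vars fun hj => ?_
  obtain ⟨k, -, hk⟩ := Finset.mem_image.1 (vars_rename Sum.inl f hj)
  cases hk

lemma pderiv_inl_holo (j : Option σ) (f : MvPolynomial (Option σ) ℂ) :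
    pderiv (Sum.inl j) (holo f) = holo (pderiv j f) :=
  pderiv_rename Sum.inl_injective j f

lemma IsWick.holo_eq {E : MvPolynomial (Option σ ⊕ Option σ) ℂ →ₗ[ℂ] ℂ} {y : Option σ → ℂ}
    (hE : IsWick E y) (f : MvPolynomial (Option σ) ℂ) : E (holo f) = eval y f := by
  induction f using MvPolynomial.induction_on with
  | C a => rw [algHom_C, Algebra.algebraMap_eq_smul_one, map_smul, hE.one, eval_C, smul_eq_mul,
      mul_one]
  | add p q hp hq => rw [map_add, map_add, map_add, hp, hq]
  | mul_X p j hp =>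
    rw [mul_comm, map_mul, rename_X, hE.inl_mul, pderiv_inr_holo, hp, map_mul, eval_X, map_zero,
      add_zero]

variable [Fintype σ]

/-- The polynomial `w₀ + ∑ wᵢ hᵢ(z)`, whose moments compute the homogeneous components of the
formal inverse of `z - z₀ h(z)`. -/
noncomputable def symbol (h : σ → MvPolynomial (Option σ) ℂ) :
    MvPolynomial (Option σ ⊕ Option σ) ℂ :=
  X (Sum.inr none) + ∑ i, X (Sum.inr (some i)) * holo (h i)

variable (h : σ → MvPolynomial (Option σ) ℂ)

lemma pderiv_inr_none_symbol : pderiv (Sum.inr none) (symbol h) = 1 := by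
  classical
  simp only [symbol, map_add, map_sum, Derivation.leibniz, pderiv_inr_holo, pderiv_X]
  simp

lemma pderiv_inr_some_symbol (i : σ) : pderiv (Sum.inr (some i)) (symbol h) = holo (h i) := by
  classical
  simp only [symbol, map_add, map_sum, Derivation.leibniz, pderiv_inr_holo, pderiv_X]
  simp [Pi.single_apply]

lemma pderiv_inl_symbol (k : Option σ) : pderiv (Sum.inl k) (symbol h)
    = ∑ i, X (Sum.inr (some i)) * holo (pderiv k (h i)) := by
  classical
  simp only [symbol, map_add, map_sum, Derivation.leibniz, pderiv_inl_holo, pderiv_X]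
  simp

variable {h} {E : MvPolynomial (Option σ ⊕ Option σ) ℂ →ₗ[ℂ] ℂ} {y : Option σ → ℂ}

/-- Multiplication by `z₀` lowers the moment by one. -/
lemma IsWick.symbol_pow_mul_X_none (hE : IsWick E y) (hy : y none = 0) (m : ℕ)
    (Q : MvPolynomial (Option σ ⊕ Option σ) ℂ) (hQ : pderiv (Sum.inr none) Q = 0) :
    E (symbol h ^ m * (holo (X none) * Q)) = m * E (symbol h ^ (m - 1) * Q) := by
  rw [rename_X, mul_left_comm, hE.inl_mul, hy, zero_mul, zero_add, Derivation.leibniz, hQ,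
    Derivation.leibniz_pow, pderiv_inr_none_symbol, smul_zero, zero_add, smul_eq_mul, smul_eq_mul,
    mul_one, mul_comm, smul_mul_assoc, map_nsmul, nsmul_eq_mul]

lemma IsWick.symbol_pow_mul_X_none_pow (hE : IsWick E y) (hy : y none = 0) (k m : ℕ)
    (f : MvPolynomial (Option σ) ℂ) :
    E (symbol h ^ m * holo (X none ^ k * f))
      = m.descFactorial k * E (symbol h ^ (m - k) * holo f) := by
  induction k generalizing f with
  | zero => simp
  | succ k ih =>
    rw [pow_succ, mul_assoc, ih, map_mul holo,
      hE.symbol_pow_mul_X_none hy _ _ (pderiv_inr_holo _ _), Nat.descFactorial_succ, Nat.sub_sub]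
    push_cast
    ring

lemma IsWick.symbol_pow_mul_coord (hE : IsWick E y) (hy : y none = 0) (m : ℕ) (i : σ)
    (f : MvPolynomial (Option σ) ℂ) :
    E (symbol h ^ m * holo ((X (some i) - X none * h i) * f))
      = y (some i) * E (symbol h ^ m * holo f) := by
  have h1 : symbol h ^ m * holo ((X (some i) - X none * h i) * f)
      = X (Sum.inl (some i)) * (symbol h ^ m * holo f)
        - symbol h ^ m * (holo (X none) * holo (h i * f)) := by
    simp only [map_mul, map_sub, rename_X]
    ring
  rw [h1, map_sub, hE.symbol_pow_mul_X_none hy _ _ (pderiv_inr_holo _ _), hE.inl_mul,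
    Derivation.leibniz, pderiv_inr_holo, Derivation.leibniz_pow, pderiv_inr_some_symbol,
    smul_zero, zero_add, smul_eq_mul, smul_eq_mul, mul_smul_comm, map_nsmul, map_mul holo (h i),
    nsmul_eq_mul, mul_left_comm (holo f), mul_comm (holo f)]
  ring

lemma IsWick.symbol_pow_mul_aeval (hE : IsWick E y) (hy : y none = 0) (m : ℕ)
    (u : MvPolynomial σ ℂ) :
    E (symbol h ^ m * holo (aeval (fun i => X (some i) - X none * h i) u))
      = eval (fun i => y (some i)) u * E (symbol h ^ m) := by
  induction u using MvPolynomial.induction_on with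
  | C a => rw [algHom_C, AlgHom.commutes, mul_comm, ← Algebra.smul_def, map_smul, eval_C,
      smul_eq_mul]
  | add p q hp hq => simp only [map_add, mul_add, add_mul, hp, hq]
  | mul_X p j hp =>
    rw [mul_comm p, map_mul (aeval _), aeval_X, hE.symbol_pow_mul_coord hy, hp, map_mul, eval_X,
      mul_assoc]

/-- If the Jacobian matrix of `z - z₀ h(z)` has an inverse with divergence free columns, then
the moments of the symbol are orthogonal to the antiholomorphic coordinates. -/
lemma IsWick.symbol_pow_mul_X_inr [DecidableEq σ] (hE : IsWick E y) (hy : y none = 0)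
    (B : σ → σ → MvPolynomial (Option σ) ℂ)
    (hB : ∀ i j, ∑ k, pderiv (some k) (X (some i) - X none * h i) * B k j = if i = j then 1 else 0)
    (hdiv : ∀ j, ∑ k, pderiv (some k) (B k j) = 0) (m : ℕ) (j : σ) :
    E (X (Sum.inr (some j)) * symbol h ^ m) = 0 := by
  have h1 (k : σ) : E (symbol h ^ m * (X (Sum.inr (some k)) * holo (B k j)))
      = E (symbol h ^ m * holo (pderiv (some k) (B k j)))
        + ∑ i, E (symbol h ^ m * (X (Sum.inr (some i)) *
            holo (X none * pderiv (some k) (h i) * B k j))) := by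
    have h2 (i : σ) : E (symbol h ^ m * (X (Sum.inr (some i)) *
            holo (X none * pderiv (some k) (h i) * B k j)))
        = m * E (symbol h ^ (m - 1) * (X (Sum.inr (some i)) *
            holo (pderiv (some k) (h i) * B k j))) := by
      rw [mul_assoc, map_mul holo, mul_left_comm (X _) (holo (X none)),
        hE.symbol_pow_mul_X_none hy]
      rw [Derivation.leibniz, pderiv_inr_holo, pderiv_X_of_ne (by simp)]
      simp
    rw [mul_left_comm, hE.inr_mul, Derivation.leibniz, pderiv_inl_holo, Derivation.leibniz_pow,
      pderiv_inl_symbol, map_add, smul_eq_mul, smul_eq_mul, smul_eq_mul, mul_smul_comm,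
      map_nsmul, nsmul_eq_mul]
    simp only [h2, ← Finset.mul_sum, ← map_sum]
    congr 3
    rw [Finset.mul_sum, Finset.mul_sum, Finset.mul_sum]
    refine Finset.sum_congr rfl fun i _ => ?_
    rw [map_mul]
    ring
  have h3 (i : σ) : ∑ k, X none * pderiv (some k) (h i) * B k j
      = B i j - if i = j then 1 else 0 := by
    rw [← hB i j]
    simp only [map_sub, Derivation.leibniz, pderiv_X, sub_mul, Finset.sum_sub_distrib]
    simp [Pi.single_apply]
  have h4 := Finset.sum_congr (rfl : (Finset.univ : Finset σ) = Finset.univ) fun k _ => h1 k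
  rw [Finset.sum_add_distrib, Finset.sum_comm] at h4
  simp only [← map_sum, ← Finset.mul_sum, h3, hdiv] at h4
  simp only [map_zero, mul_zero, zero_add, map_sub, mul_sub, Finset.sum_sub_distrib,
    apply_ite holo, map_one, mul_ite, mul_one] at h4
  rw [Finset.sum_ite_eq' Finset.univ j, if_pos (Finset.mem_univ j), eq_comm, sub_eq_self] at h4
  rwa [mul_comm]

/-- Under the same hypothesis, the moments of a symbol of weight two vanish. -/
lemma IsWick.symbol_pow_eq_zero [DecidableEq σ] (hE : IsWick E y) (hy : y none = 0)
    (hw : ∀ i, ∑ k, X (some k) * pderiv (some k) (h i) - X none * pderiv none (h i) = 2 * h i)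
    (hz : ∀ m j, E (X (Sum.inr (some j)) * symbol h ^ m) = 0)
    (m : ℕ) (hm : 1 ≤ m) : E (symbol h ^ m) = 0 := by
  have h1 (j : Option σ) : E (X (Sum.inl j) * pderiv (Sum.inl j) (symbol h ^ m)
      - X (Sum.inr j) * pderiv (Sum.inr j) (symbol h ^ m)) = 0 := by
    have h2 : y j * E (pderiv (Sum.inl j) (symbol h ^ m)) = 0 := by
      cases j with
      | none => rw [hy, zero_mul]
      | some j => rw [← hE.inr_mul, hz, mul_zero]
    rw [map_sub, hE.inl_mul, hE.inr_mul, h2, pderiv_pderiv_comm, zero_add, sub_self]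
  have h2 : ∑ k, (X (Sum.inl (some k)) * pderiv (Sum.inl (some k)) (symbol h)
        - X (Sum.inr (some k)) * pderiv (Sum.inr (some k)) (symbol h))
      - (X (Sum.inl none) * pderiv (Sum.inl none) (symbol h)
        - X (Sum.inr none) * pderiv (Sum.inr none) (symbol h)) = symbol h := by
    have h3 (i : σ) : holo (h i) = ∑ k, X (Sum.inl (some k)) * holo (pderiv (some k) (h i))
        - X (Sum.inl none) * holo (pderiv none (h i)) - holo (h i) := by
      have h4 := congrArg holo (hw i)
      simp only [map_sub, map_sum, map_mul, rename_X, map_ofNat] at h4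
      rw [h4]
      ring
    simp only [pderiv_inl_symbol, pderiv_inr_none_symbol, pderiv_inr_some_symbol]
    conv_rhs => rw [symbol]; enter [2, 2, i]; rw [h3 i]
    simp only [mul_sub, Finset.sum_sub_distrib, Finset.mul_sum, mul_one]
    rw [Finset.sum_comm]
    simp only [mul_left_comm (X (Sum.inl _))]
    ring
  have h3 : ∑ k, (X (Sum.inl (some k)) * pderiv (Sum.inl (some k)) (symbol h ^ m)
        - X (Sum.inr (some k)) * pderiv (Sum.inr (some k)) (symbol h ^ m))
      - (X (Sum.inl none) * pderiv (Sum.inl none) (symbol h ^ m)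
        - X (Sum.inr none) * pderiv (Sum.inr none) (symbol h ^ m)) = m • symbol h ^ m := by
    have h4 (D : MvPolynomial (Option σ ⊕ Option σ) ℂ) (v : Option σ ⊕ Option σ) :
        D * pderiv v (symbol h ^ m) = m • symbol h ^ (m - 1) * (D * pderiv v (symbol h)) := by
      rw [Derivation.leibniz_pow, smul_eq_mul, nsmul_eq_mul, nsmul_eq_mul]
      ring
    simp only [h4, ← mul_sub, ← Finset.mul_sum]
    rw [h2, smul_mul_assoc, ← pow_succ, Nat.sub_add_cancel hm]
  have h5 := congrArg E h3
  rw [map_sub, map_sum, h1, Finset.sum_eq_zero fun k _ => h1 (some k), sub_zero, map_nsmul,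
    nsmul_eq_mul] at h5
  exact (mul_eq_zero.1 h5.symm).resolve_left (Nat.cast_ne_zero.2 (by omega))

/-- A polynomial in `z` is determined by its pairings with the powers of the symbol. -/
lemma eq_zero_of_symbol_pow_mul_eq_zero
    {E : (σ → ℂ) → MvPolynomial (Option σ ⊕ Option σ) ℂ →ₗ[ℂ] ℂ}
    (hE : ∀ y, IsWick (E y) fun i => i.elim 0 y) (f : MvPolynomial (Option σ) ℂ)
    (hf : ∀ y m, E y (symbol h ^ m * holo f) = 0) : f = 0 := by
  suffices H : ∀ (r : ℕ) (p : Polynomial (MvPolynomial σ ℂ)),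
      (∀ y m, E y (symbol h ^ m * holo ((optionEquivLeft ℂ σ).symm p)) = 0) → p.coeff r = 0 by
    rw [← (optionEquivLeft ℂ σ).symm_apply_apply f,
      Polynomial.ext (p := optionEquivLeft ℂ σ f) (q := 0)
        fun r => by rw [H r _ (by simpa using hf), Polynomial.coeff_zero], map_zero]
  have hC : ∀ p : Polynomial (MvPolynomial σ ℂ),
      (∀ y m, E y (symbol h ^ m * holo ((optionEquivLeft ℂ σ).symm p)) = 0) → p.coeff 0 = 0 := by
    intro p hp
    refine MvPolynomial.funext fun y => ?_
    have h1 := hp y 0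
    rw [pow_zero, one_mul, (hE y).holo_eq] at h1
    conv_lhs at h1 => rw [← Polynomial.divX_mul_X_add p]
    simpa [optionEquivLeft_symm_apply, Polynomial.aevalTower_X, eval_rename,
      Function.comp_def] using h1
  intro r
  induction r with
  | zero => exact hC
  | succ r ih =>
    intro p hp
    rw [← Polynomial.coeff_divX]
    refine ih _ fun y m => ?_
    have h1 := hp y (m + 1)
    rw [← Polynomial.divX_mul_X_add p, hC p hp, map_zero, add_zero, mul_comm p.divX,
      map_mul (optionEquivLeft ℂ σ).symm, optionEquivLeft_symm_apply, Polynomial.aevalTower_X,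
      map_mul holo,
      (hE y).symbol_pow_mul_X_none rfl _ _ (pderiv_inr_holo _ _), Nat.add_sub_cancel] at h1
    exact (mul_eq_zero.1 h1).resolve_left (Nat.cast_ne_zero.2 m.succ_ne_zero)

end Inversion

section JacobianConjecture

open MvPolynomial

variable {σ : Type*}

/-- The substitution `p ↦ p (z₀ z)`. -/
noncomputable def scale : MvPolynomial σ ℂ →ₐ[ℂ] MvPolynomial (Option σ) ℂ :=
  aeval fun k => X none * X (some k)

lemma aeval_elim_scale (p : MvPolynomial σ ℂ) :
    aeval (fun i : Option σ => i.elim (1 : MvPolynomial σ ℂ) X) (scale p) = p := by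
  rw [scale, ← AlgHom.comp_apply, comp_aeval]
  simp

/-- A left inverse of a polynomial map inverts it on points. -/
lemma eval_eval_of_aeval_eq_X {F G : σ → MvPolynomial σ ℂ} (hGF : ∀ i, aeval F (G i) = X i)
    (x : σ → ℂ) : (fun i => eval (fun j => eval x (F j)) (G i)) = x := by
  funext i
  have h := congrArg (eval x) (hGF i)
  rw [eval_X, aeval_def, algebraMap_eq, eval_eval₂,
    show (eval x).comp C = RingHom.id ℂ from RingHom.ext (eval_C (f := x))] at h
  exact h

variable [Fintype σ]

lemma pderiv_some_scale (k : σ) (p : MvPolynomial σ ℂ) :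
    pderiv (some k) (scale p) = X none * scale (pderiv k p) := by
  classical
  rw [scale, derivation_aeval]
  simp [pderiv_X, Pi.single_apply, mul_comm]

/-- A polynomial without terms of degree less than two is divisible by `z₀ ^ 2` after scaling. -/
lemma X_none_sq_dvd_scale (p : MvPolynomial σ ℂ) (h0 : eval 0 p = 0)
    (h1 : ∀ k, eval 0 (pderiv k p) = 0) : X none ^ 2 ∣ scale p := by
  have hc (q : MvPolynomial σ ℂ) : eval 0 q = coeff 0 q := by
    rw [eval_zero, constantCoeff_eq]
  rw [← support_sum_monomial_coeff p, map_sum]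
  refine Finset.dvd_sum fun m hm => ?_
  have hdeg : 2 ≤ m.degree := by
    by_contra hlt
    have hcases : m.degree = 0 ∨ m.degree = 1 := by omega
    rcases hcases with h | h
    · rw [Finsupp.degree_eq_zero_iff] at h
      exact mem_support_iff.1 hm (by rw [h, ← hc, h0])
    · obtain ⟨k, rfl⟩ := (Finsupp.range_single_one (σ := σ)).superset h
      have h2 := h1 k
      rw [hc, coeff_pderiv] at h2
      exact mem_support_iff.1 hm (by simpa using h2)
  rw [scale, aeval_monomial, Finsupp.prod_pow]
  simp only [mul_pow, Finset.prod_mul_distrib, Finset.prod_pow_eq_pow_sum]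
  rw [← Finsupp.degree_eq_sum]
  exact ((pow_dvd_pow _ hdeg).mul_right _).mul_left _

lemma sum_X_mul_pderiv_of_sq_mul_eq_scale {f : MvPolynomial (Option σ) ℂ} {p : MvPolynomial σ ℂ}
    (hf : scale p = X none ^ 2 * f) :
    ∑ k, X (some k) * pderiv (some k) f - X none * pderiv none f = 2 * f := by
  classical
  obtain ⟨D, hD0, hD1⟩ : ∃ D : Derivation ℂ (MvPolynomial (Option σ) ℂ) (MvPolynomial (Option σ) ℂ),
      D (X none) = -X none ∧ ∀ k, D (X (some k)) = X (some k) :=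
    ⟨mkDerivation ℂ fun i => i.elim (-X none) fun k => X (some k), mkDerivation_X ℂ _ _,
      fun _ => mkDerivation_X ℂ _ _⟩
  have hD (g : MvPolynomial (Option σ) ℂ) :
      D g = ∑ k, X (some k) * pderiv (some k) g - X none * pderiv none g := by
    have h1 := derivation_aeval D X g
    rw [aeval_X_left, AlgHom.id_apply, Fintype.sum_option] at h1
    rw [h1]
    simp only [hD0, hD1, AlgHom.id_apply, mul_comm (pderiv _ g)]
    ring
  have h0 : D (scale p) = 0 := by
    rw [scale, derivation_aeval]
    refine Finset.sum_eq_zero fun k _ => ?_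
    simp only [Derivation.leibniz, hD0, hD1, smul_eq_mul]
    ring
  rw [hf, Derivation.leibniz, Derivation.leibniz_pow] at h0
  rw [← hD]
  refine mul_left_cancel₀ (pow_ne_zero 2 (X_ne_zero (R := ℂ) (none : Option σ))) ?_
  simp only [hD0, smul_eq_mul, nsmul_eq_mul, Nat.cast_ofNat, Nat.add_one_sub_one, pow_one] at h0
  linear_combination h0

/-- The columns of the adjugate of a unimodular Jacobian matrix are divergence free. -/
lemma sum_pderiv_adjugate [DecidableEq σ] (F : σ → MvPolynomial σ ℂ)
    (hF : (Matrix.of fun i j => pderiv j (F i)).det = 1) (j : σ) :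
    ∑ k, pderiv k ((Matrix.of fun i j => pderiv j (F i)).adjugate k j) = 0 := by
  set M : Matrix σ σ (MvPolynomial σ ℂ) := Matrix.of fun i j => pderiv j (F i) with hM
  have hright (a : σ) : ∑ b, M a b * M.adjugate b j = (1 : Matrix σ σ (MvPolynomial σ ℂ)) a j := by
    rw [← Matrix.mul_apply, Matrix.mul_adjugate, hF, one_smul]
  have hleft (k b : σ) : ∑ a, M.adjugate k a * M a b
      = (1 : Matrix σ σ (MvPolynomial σ ℂ)) k b := by
    rw [← Matrix.mul_apply, Matrix.adjugate_mul, hF, one_smul]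
  have hdiff (k a : σ) : ∑ b, M a b * pderiv k (M.adjugate b j)
      = -∑ b, M.adjugate b j * pderiv k (M a b) := by
    have h1 := congrArg (pderiv k) (hright a)
    rw [map_sum, Matrix.one_apply, apply_ite (pderiv k), pderiv_one, map_zero, ite_self] at h1
    simp only [Derivation.leibniz, smul_eq_mul, Finset.sum_add_distrib] at h1
    exact eq_neg_of_add_eq_zero_left h1
  have hdet (b : σ) : ∑ k, ∑ a, M.adjugate k a * pderiv b (M a k) = 0 := by
    rw [← derivation_det, hF, pderiv_one]
  have hcomm (k a b : σ) : pderiv k (M a b) = pderiv b (M a k) := by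
    rw [hM, Matrix.of_apply, Matrix.of_apply, pderiv_pderiv_comm]
  have hswap (f : σ → σ → σ → MvPolynomial σ ℂ) :
      ∑ k, ∑ a, ∑ b, f k a b = ∑ b, ∑ k, ∑ a, f k a b := by
    rw [Finset.sum_comm (f := fun b k => ∑ a, f k a b)]
    exact Finset.sum_congr rfl fun k _ => Finset.sum_comm
  clear_value M
  generalize M.adjugate = A at hright hleft hdiff hdet ⊢
  calc ∑ k, pderiv k (A k j)
      = ∑ k, ∑ b, (∑ a, A k a * M a b) * pderiv k (A b j) := by
        simp [hleft, Matrix.one_apply]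
    _ = ∑ k, ∑ a, A k a * ∑ b, M a b * pderiv k (A b j) := by
        refine Finset.sum_congr rfl fun k _ => ?_
        simp only [Finset.sum_mul, Finset.mul_sum]
        rw [Finset.sum_comm]
        simp only [mul_assoc]
    _ = -∑ k, ∑ a, ∑ b, A b j * (A k a * pderiv b (M a k)) := by
        simp only [hdiff, mul_neg, Finset.sum_neg_distrib, Finset.mul_sum]
        refine congrArg Neg.neg ?_
        refine Finset.sum_congr rfl fun k _ => Finset.sum_congr rfl fun a _ =>
          Finset.sum_congr rfl fun b _ => ?_
        rw [hcomm, mul_left_comm]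
    _ = -∑ b, A b j * ∑ k, ∑ a, A k a * pderiv b (M a k) := by
        rw [hswap]
        simp only [Finset.mul_sum]
    _ = 0 := by simp [hdet]

/-- A sequence of polynomials that is eventually zero at every point is eventually zero. -/
lemma eventually_eq_zero_of_eval (q : ℕ → MvPolynomial σ ℂ)
    (hq : ∀ y, ∃ N, ∀ m, N ≤ m → eval y (q m) = 0) : ∃ N, ∀ m, N ≤ m → q m = 0 := by
  have hclosed (N : ℕ) : IsClosed {y : σ → ℂ | ∀ m, N ≤ m → eval y (q m) = 0} := by
    simp only [Set.ofPred_forall]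
    exact isClosed_iInter fun m => isClosed_iInter fun _ =>
      isClosed_eq (continuous_eval (q m)) continuous_const
  obtain ⟨N, y, hy⟩ := nonempty_interior_of_iUnion_of_closed hclosed
    (Set.eq_univ_of_forall fun y => Set.mem_iUnion.2 (hq y))
  refine ⟨N, fun m hm => ?_⟩
  obtain ⟨ε, hε, hball⟩ := Metric.mem_nhds_iff.1 (mem_interior_iff_mem_nhds.1 hy)
  rw [ball_pi y hε] at hball
  refine funext_set (fun i => Metric.ball (y i) ε) (fun i => ?_) fun x hx => ?_
  · exact infinite_of_mem_nhds (y i) (Metric.ball_mem_nhds _ hε)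
  · rw [hball hx m hm, map_zero]

/-- The Gaussian Moments Conjecture inverts polynomial maps with unimodular Jacobian matrix that
are tangent to the identity at the origin. -/
lemma exists_leftInverse_of_tangent_id [DecidableEq σ] (hG : ∀ n : ℕ, 1 ≤ n → GMC n)
    (F : σ → MvPolynomial σ ℂ) (hF0 : ∀ i, eval 0 (F i) = 0)
    (hF1 : ∀ i j, eval 0 (pderiv j (F i)) = if i = j then 1 else 0)
    (hdet : (Matrix.of fun i j => pderiv j (F i)).det = 1) :
    ∃ G : σ → MvPolynomial σ ℂ, ∀ i, aeval F (G i) = X i := by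
  set M : Matrix σ σ (MvPolynomial σ ℂ) := Matrix.of fun i j => pderiv j (F i) with hM
  have hdvd (i : σ) : X none ^ 2 ∣ scale (X i - F i) := by
    refine X_none_sq_dvd_scale _ (by rw [map_sub, eval_X, hF0, Pi.zero_apply, sub_zero]) fun k => ?_
    rw [map_sub, map_sub, hF1, pderiv_X, Pi.single_apply]
    split_ifs <;> simp
  choose h hh using hdvd
  have hX : X none ≠ (0 : MvPolynomial (Option σ) ℂ) := X_ne_zero _
  have hFs (i : σ) : X none * (X (some i) - X none * h i) = scale (F i) := by
    have h1 := hh i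
    rw [map_sub, scale, aeval_X, ← scale] at h1
    linear_combination h1
  have hJ (i k : σ) : pderiv (some k) (X (some i) - X none * h i) = scale (M i k) := by
    have h1 := congrArg (pderiv (some k)) (hFs i)
    rw [Derivation.leibniz, pderiv_X_of_ne (by simp), smul_zero, add_zero, pderiv_some_scale] at h1
    exact mul_left_cancel₀ hX h1
  have hB (i j : σ) : ∑ k, pderiv (some k) (X (some i) - X none * h i) * scale (M.adjugate k j)
      = if i = j then 1 else 0 := by
    simp only [hJ, ← map_mul, ← map_sum]
    rw [← Matrix.mul_apply, Matrix.mul_adjugate, hdet, one_smul, Matrix.one_apply, apply_ite scale,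
      map_one, map_zero]
  have hdiv (j : σ) : ∑ k, pderiv (some k) (scale (M.adjugate k j)) = 0 := by
    simp only [pderiv_some_scale, ← Finset.mul_sum, ← map_sum]
    rw [sum_pderiv_adjugate F hdet, map_zero, mul_zero]
  have hw (y : σ → ℂ) : IsWick (wick fun i : Option σ => i.elim 0 y) fun i => i.elim 0 y :=
    isWick_wick _
  have hvanish (y : σ → ℂ) (m : ℕ) (hm : 1 ≤ m) :
      wick (fun i : Option σ => i.elim 0 y) (symbol h ^ m) = 0 :=
    (hw y).symbol_pow_eq_zero rfl (fun i => sum_X_mul_pderiv_of_sq_mul_eq_scale (hh i))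
      ((hw y).symbol_pow_mul_X_inr rfl (fun k j => scale (M.adjugate k j)) hB hdiv) m hm
  have hq (i : σ) (m : ℕ) : ∃ q : MvPolynomial σ ℂ, ∀ y : σ → ℂ,
      wick (fun i : Option σ => i.elim 0 y) (symbol h ^ m * holo (X (some i))) = eval y q := by
    obtain ⟨q, hq⟩ := exists_eval_eq_wick (symbol h ^ m * holo (X (some i)))
    refine ⟨aeval (fun i : Option σ => i.elim (0 : MvPolynomial σ ℂ) X) q, fun y => ?_⟩
    rw [hq, ← coe_aeval_eq_eval, ← coe_aeval_eq_eval, RingHom.coe_coe, RingHom.coe_coe,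
      ← AlgHom.comp_apply, comp_aeval]
    congr 2
    funext i
    cases i <;> simp
  choose q hq using hq
  have hN (i : σ) : ∃ N, ∀ m, N ≤ m → q i m = 0 :=
    eventually_eq_zero_of_eval (q i) fun y => by
      simp only [← hq]
      exact gmc_wick hG _ _ (hvanish y) _
  choose N hN using hN
  let u (i : σ) (m : ℕ) : MvPolynomial σ ℂ := C ((m.factorial : ℂ)⁻¹) * q i m
  refine ⟨fun i => ∑ m ∈ Finset.range (N i), u i m, fun i => ?_⟩
  have hpair (y : σ → ℂ) (m k : ℕ) : wick (fun i : Option σ => i.elim 0 y)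
      (symbol h ^ m * holo (X none ^ k * aeval (fun i => X (some i) - X none * h i) (u i k)))
      = if m = k then eval y (q i m) else 0 := by
    rw [(hw y).symbol_pow_mul_X_none_pow rfl, (hw y).symbol_pow_mul_aeval rfl]
    rcases lt_trichotomy m k with hlt | rfl | hlt
    · rw [Nat.descFactorial_of_lt hlt, if_neg hlt.ne, Nat.cast_zero, zero_mul]
    · rw [if_pos rfl, Nat.sub_self, pow_zero, (hw y).one, Nat.descFactorial_self, mul_one]
      simp only [u, map_mul, eval_C, Option.elim]
      rw [mul_inv_cancel_left₀ (Nat.cast_ne_zero.2 m.factorial_ne_zero)]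
    · rw [if_neg hlt.ne', hvanish y _ (by omega), mul_zero, mul_zero]
  have hzero := eq_zero_of_symbol_pow_mul_eq_zero (h := h) hw
    (∑ k ∈ Finset.range (N i), X none ^ k * aeval (fun i => X (some i) - X none * h i) (u i k)
      - X (some i)) fun y m => by
    rw [map_sub, map_sum, mul_sub, Finset.mul_sum, map_sub, map_sum, hq]
    simp only [hpair]
    rw [Finset.sum_ite_eq (Finset.range (N i)) m]
    split_ifs with hm
    · exact sub_self _
    · rw [hN i m (by simpa using hm), map_zero, sub_zero]
  obtain ⟨θ, hθ⟩ : ∃ θ : MvPolynomial (Option σ) ℂ →ₐ[ℂ] MvPolynomial σ ℂ,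
      θ = aeval fun i => i.elim 1 X := ⟨_, rfl⟩
  have hθ0 : θ (X none) = 1 := by rw [hθ, aeval_X, Option.elim]
  have hθ1 (i : σ) : θ (X (some i)) = X i := by rw [hθ, aeval_X, Option.elim]
  have hθF (i : σ) : θ (X (some i) - X none * h i) = F i := by
    have h1 := congrArg θ (hFs i)
    rwa [map_mul, hθ0, one_mul, hθ, aeval_elim_scale, ← hθ] at h1
  have hθu (p : MvPolynomial σ ℂ) :
      θ (aeval (fun i => X (some i) - X none * h i) p) = aeval F p := by
    rw [← AlgHom.comp_apply, comp_aeval, _root_.funext hθF]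
  have h1 := congrArg θ hzero
  simp only [map_sub θ, map_sum, map_mul θ, map_pow, hθ0, hθ1, hθu, one_pow, one_mul, map_zero] at h1
  rw [map_sum, ← sub_eq_zero, ← h1]

/-- The Gaussian Moments Conjecture gives left inverses of polynomial maps with constant nonzero
Jacobian determinant. -/
lemma exists_leftInverse [DecidableEq σ] (hG : ∀ n : ℕ, 1 ≤ n → GMC n)
    (F : σ → MvPolynomial σ ℂ) {c : ℂ} (hc : c ≠ 0)
    (hdet : (Matrix.of fun i j => pderiv j (F i)).det = C c) :
    ∃ G : σ → MvPolynomial σ ℂ, ∀ i, aeval F (G i) = X i := by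
  set M : Matrix σ σ (MvPolynomial σ ℂ) := Matrix.of fun i j => pderiv j (F i) with hM
  obtain ⟨A, hA⟩ : ∃ A : Matrix σ σ ℂ, A = (eval (0 : σ → ℂ)).mapMatrix M := ⟨_, rfl⟩
  have hAdet : A.det = c := by rw [hA, ← RingHom.map_det, hdet, eval_C]
  have hAunit : IsUnit A.det := by rw [hAdet]; exact hc.isUnit
  let F' (i : σ) : MvPolynomial σ ℂ := ∑ j, C (A⁻¹ i j) * (F j - C (eval 0 (F j)))
  have hF' (i k : σ) : pderiv k (F' i) = ((C (σ := σ)).mapMatrix A⁻¹ * M) i k := by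
    simp only [F', map_sum, Derivation.leibniz, map_sub, pderiv_C, sub_zero, smul_eq_mul,
      mul_zero, add_zero, Matrix.mul_apply, RingHom.mapMatrix_apply, Matrix.map_apply, hM,
      Matrix.of_apply]
  obtain ⟨G, hGF⟩ := exists_leftInverse_of_tangent_id hG F'
    (fun i => by simp only [F', map_sum, map_mul, map_sub, eval_C, sub_self, mul_zero,
      Finset.sum_const_zero])
    (fun i k => by
      rw [hF', ← Matrix.one_apply, ← Matrix.nonsing_inv_mul A hAunit, Matrix.mul_apply,
        Matrix.mul_apply, map_sum]
      simp only [map_mul, RingHom.mapMatrix_apply, Matrix.map_apply, eval_C, hA])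
    (by
      rw [show Matrix.of (fun i j => pderiv j (F' i)) = (C (σ := σ)).mapMatrix A⁻¹ * M from
        Matrix.ext hF', Matrix.det_mul, ← RingHom.map_det, hdet, ← map_mul, ← hAdet,
        ← Matrix.det_mul, Matrix.nonsing_inv_mul A hAunit, Matrix.det_one, map_one])
  refine ⟨fun i => aeval (fun i => ∑ j, C (A⁻¹ i j) * (X j - C (eval 0 (F j)))) (G i), fun i => ?_⟩
  rw [← hGF, ← AlgHom.comp_apply, comp_aeval]
  congr 2
  funext k
  simp only [F', map_sum, map_mul, map_sub, aeval_X, algHom_C, algebraMap_eq]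

/-- A surjective endomorphism of a Noetherian ring is injective. -/
lemma injective_of_surjective_ringHom {R : Type*} [CommRing R] [IsNoetherianRing R] (φ : R →+* R)
    (hφ : Function.Surjective φ) : Function.Injective φ := by
  have hmono : Monotone fun n : ℕ => RingHom.ker (φ ^ n) :=
    monotone_nat_of_le_succ fun n x hx => by
      rw [RingHom.mem_ker] at hx ⊢
      rw [pow_succ', RingHom.mul_def, RingHom.comp_apply, hx, map_zero]
  obtain ⟨n, hn⟩ := monotone_stabilizes_iff_noetherian.2 ‹IsNoetherianRing R› ⟨_, hmono⟩
  refine (injective_iff_map_eq_zero φ).2 fun x hx => ?_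
  obtain ⟨z, rfl⟩ : ∃ z, (φ ^ n) z = x := by
    rw [RingHom.coe_pow]
    exact hφ.iterate n x
  have hz : z ∈ RingHom.ker (φ ^ (n + 1)) := by
    rwa [RingHom.mem_ker, pow_succ', RingHom.mul_def, RingHom.comp_apply]
  exact (SetLike.ext_iff.1 (hn (n + 1) n.le_succ) z).2 hz

/-- A left inverse of a polynomial map is a right inverse. -/
lemma aeval_eq_X_of_aeval_eq_X {F G : σ → MvPolynomial σ ℂ} (hGF : ∀ i, aeval F (G i) = X i)
    (i : σ) : aeval G (F i) = X i := by
  have hcomp (p : MvPolynomial σ ℂ) : aeval F (aeval G p) = p := by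
    rw [← AlgHom.comp_apply, comp_aeval, _root_.funext hGF, aeval_X_left, AlgHom.id_apply]
  refine injective_of_surjective_ringHom (aeval F : MvPolynomial σ ℂ →ₐ[ℂ] _).toRingHom
    (fun p => ⟨aeval G p, hcomp p⟩) ?_
  exact (hcomp (F i)).trans (aeval_X F i).symm

end JacobianConjecture

/-- if `GMC(n)` holds for all `n ≥ 1` then `JC(n)` holds for all `n ≥ 1`. -/
theorem gmc_implies_jc (h : ∀ n : ℕ, 1 ≤ n → GMC n) : ∀ n : ℕ, 1 ≤ n → JC n := by
  rintro n - F ⟨c, hc, hdet⟩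
  obtain ⟨G, hGF⟩ := exists_leftInverse h F hc hdet
  exact ⟨G, eval_eval_of_aeval_eq_X hGF, eval_eval_of_aeval_eq_X (aeval_eq_X_of_aeval_eq_X hGF)⟩
end

section
/- If Ker(Fₙ) is an MZ space of ℂ[w₁,…,wₙ,z₁,…,zₙ], then Ker(Eₙ) is an MZ space of ℂ[w₁,…,wₙ,z₁,…,zₙ]. -/
open MeasureTheory

/-- A Mathieu–Zhao space of a commutative unital `ℂ`-algebra `A`: a `ℂ`-linear subspace
`V ⊆ A` such that whenever `f^m ∈ V` for all `m ≥ 1`, for every `g ∈ A` one has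
`f^m * g ∈ V` for all sufficiently large `m`. -/
def IsMZSpace {A : Type*} [CommRing A] [Algebra ℂ A] (V : Set A) : Prop :=
  (∃ W : Submodule ℂ A, (W : Set A) = V) ∧
    ∀ f : A, (∀ m : ℕ, 1 ≤ m → f ^ m ∈ V) →
      ∀ g : A, ∃ N : ℕ, ∀ m : ℕ, N ≤ m → f ^ m * g ∈ V

/-- The linear map `Eₙ : ℂ[w,z] → ℂ[z]` determined on monomials by
`Eₙ(w^α z^β) = ∂^α (z^β)`, where `∂^α = ∂₁^{α₁} ⋯ ∂ₙ^{αₙ}`.  Here `ℂ[w,z]` is the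
polynomial ring in the variables `wᵢ = X (Sum.inl i)` and `zᵢ = X (Sum.inr i)`. -/
noncomputable def En (n : ℕ) :
    MvPolynomial (Fin n ⊕ Fin n) ℂ →ₗ[ℂ] MvPolynomial (Fin n) ℂ :=
  (MvPolynomial.basisMonomials (Fin n ⊕ Fin n) ℂ).constr ℂ fun d =>
    (List.finRange n).foldl
      (fun p i => (fun q => MvPolynomial.pderiv i q)^[d (Sum.inl i)] p)
      (MvPolynomial.monomial (Finsupp.equivFunOnFinite.symm fun i => d (Sum.inr i)) 1)

/-- The linear functional `Fₙ : ℂ[w,z] → ℂ`, `Fₙ(P) = Eₙ(P)|_{z=0}`. -/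
noncomputable def Fn (n : ℕ) : MvPolynomial (Fin n ⊕ Fin n) ℂ →ₗ[ℂ] ℂ :=
  (MvPolynomial.aeval (fun _ : Fin n => (0 : ℂ))).toLinearMap.comp (En n)

open MvPolynomial in
/-- The differential operator `∏ ∂ᵢ^{αᵢ}`, with `i` running through the list `l`. -/
noncomputable def iteratedPDeriv {n : ℕ} (α : Fin n → ℕ) :
    List (Fin n) → (MvPolynomial (Fin n) ℂ →ₗ[ℂ] MvPolynomial (Fin n) ℂ)
  | [] => LinearMap.id
  | i :: l => iteratedPDeriv α l ∘ₗ ((pderiv i).toLinearMap ^ α i)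

open MvPolynomial in
theorem foldl_pderiv_eq_iteratedPDeriv {n : ℕ} (α : Fin n → ℕ) (l : List (Fin n))
    (p : MvPolynomial (Fin n) ℂ) :
    l.foldl (fun p i => (fun q => pderiv i q)^[α i] p) p = iteratedPDeriv α l p := by
  induction l generalizing p with
  | nil => rfl
  | cons i l ih =>
    rw [List.foldl_cons, ih, iteratedPDeriv, LinearMap.comp_apply, Module.End.pow_apply]
    rfl

open MvPolynomial in
/-- The translation `zᵢ ↦ zᵢ + cᵢ` of `ℂ[z]`. -/
noncomputable def translateVars {n : ℕ} (c : Fin n → ℂ) :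
    MvPolynomial (Fin n) ℂ →ₐ[ℂ] MvPolynomial (Fin n) ℂ :=
  aeval fun i => X i + C (c i)

open MvPolynomial in
/-- The automorphism of `ℂ[w,z]` which fixes `wᵢ` and maps `zᵢ` to `zᵢ + cᵢ`. -/
noncomputable def translateRight {n : ℕ} (c : Fin n → ℂ) :
    MvPolynomial (Fin n ⊕ Fin n) ℂ →ₐ[ℂ] MvPolynomial (Fin n ⊕ Fin n) ℂ :=
  aeval (Sum.elim (fun i => X (Sum.inl i)) fun i => X (Sum.inr i) + C (c i))

open MvPolynomial in
theorem pderiv_translateVars {n : ℕ} (c : Fin n → ℂ) (i : Fin n) (p : MvPolynomial (Fin n) ℂ) :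
    pderiv i (translateVars c p) = translateVars c (pderiv i p) := by
  induction p using MvPolynomial.induction_on with
  | C a => simp [translateVars]
  | add p q hp hq => simp [hp, hq]
  | mul_X p j hp =>
    rw [map_mul, Derivation.leibniz, Derivation.leibniz, hp]
    simp only [smul_eq_mul, map_add, map_mul]
    by_cases hij : j = i
    · subst hij; simp [translateVars]
    · simp [translateVars, pderiv_X_of_ne hij]

theorem iteratedPDeriv_translateVars {n : ℕ} (c : Fin n → ℂ) (α : Fin n → ℕ) (l : List (Fin n))
    (p : MvPolynomial (Fin n) ℂ) :
    iteratedPDeriv α l (translateVars c p) = translateVars c (iteratedPDeriv α l p) := by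
  induction l generalizing p with
  | nil => rfl
  | cons i l ih =>
    have hpow (k : ℕ) (q : MvPolynomial (Fin n) ℂ) :
        ((MvPolynomial.pderiv i).toLinearMap ^ k) (translateVars c q) =
          translateVars c (((MvPolynomial.pderiv i).toLinearMap ^ k) q) := by
      induction k generalizing q with
      | zero => rfl
      | succ k ihk =>
        rw [pow_succ, Module.End.mul_apply, Module.End.mul_apply, ← ihk]
        exact congrArg _ (pderiv_translateVars c i q)
    rw [iteratedPDeriv, LinearMap.comp_apply, LinearMap.comp_apply, hpow, ih]

open MvPolynomial in
theorem En_monomial {n : ℕ} (d : Fin n ⊕ Fin n →₀ ℕ) :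
    En n (monomial d 1) = iteratedPDeriv (fun i => d (Sum.inl i)) (List.finRange n)
      (monomial (Finsupp.equivFunOnFinite.symm fun i => d (Sum.inr i)) 1) := by
  rw [← foldl_pderiv_eq_iteratedPDeriv]
  exact (basisMonomials (Fin n ⊕ Fin n) ℂ).constr_basis ℂ _ d

theorem mapDomain_inl_add_mapDomain_inr {n : ℕ} (α β : Fin n →₀ ℕ) :
    α.mapDomain Sum.inl + β.mapDomain Sum.inr =
      Finsupp.sumFinsuppEquivProdFinsupp.symm (α, β) := by
  ext (i | i)
  · rw [Finsupp.add_apply, Finsupp.mapDomain_apply Sum.inl_injective,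
      Finsupp.mapDomain_of_notMem_range _ _ (by simp), add_zero]
    rfl
  · rw [Finsupp.add_apply, Finsupp.mapDomain_apply Sum.inr_injective,
      Finsupp.mapDomain_of_notMem_range _ _ (by simp), zero_add]
    rfl

open MvPolynomial in
theorem En_rename_mul_rename {n : ℕ} (α : Fin n →₀ ℕ) (q : MvPolynomial (Fin n) ℂ) :
    En n (rename Sum.inl (monomial α 1) * rename Sum.inr q) =
      iteratedPDeriv α (List.finRange n) q := by
  suffices h : En n ∘ₗ LinearMap.mulLeft ℂ (rename Sum.inl (monomial α 1)) ∘ₗ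
      (rename Sum.inr).toLinearMap = iteratedPDeriv α (List.finRange n) from
    LinearMap.congr_fun h q
  refine (basisMonomials (Fin n) ℂ).ext fun β => ?_
  simp only [coe_basisMonomials, LinearMap.comp_apply, AlgHom.toLinearMap_apply,
    LinearMap.mulLeft_apply, rename_monomial, monomial_mul, mul_one]
  rw [mapDomain_inl_add_mapDomain_inr, En_monomial]
  change _ = iteratedPDeriv α (List.finRange n) (monomial β 1)
  congr 3
  ext i
  rfl

open MvPolynomial in
theorem En_translateRight {n : ℕ} (c : Fin n → ℂ) (p : MvPolynomial (Fin n ⊕ Fin n) ℂ) :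
    En n (translateRight c p) = translateVars c (En n p) := by
  suffices h : En n ∘ₗ (translateRight c).toLinearMap = (translateVars c).toLinearMap ∘ₗ En n from
    LinearMap.congr_fun h p
  refine (basisMonomials (Fin n ⊕ Fin n) ℂ).ext fun d => ?_
  obtain ⟨⟨α, β⟩, rfl⟩ := Finsupp.sumFinsuppEquivProdFinsupp.symm.surjective d
  have hd : (monomial (Finsupp.sumFinsuppEquivProdFinsupp.symm (α, β)) 1 :
      MvPolynomial (Fin n ⊕ Fin n) ℂ) =
      rename Sum.inl (monomial α 1) * rename Sum.inr (monomial β 1) := by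
    rw [rename_monomial, rename_monomial, monomial_mul, mul_one,
      mapDomain_inl_add_mapDomain_inr]
  have hl (q : MvPolynomial (Fin n) ℂ) :
      translateRight c (rename Sum.inl q) = rename Sum.inl q := by
    rw [translateRight, aeval_rename]
    refine DFunLike.congr_fun (algHom_ext fun i => ?_) q
    simp
  have hr (q : MvPolynomial (Fin n) ℂ) :
      translateRight c (rename Sum.inr q) = rename Sum.inr (translateVars c q) := by
    rw [translateRight, aeval_rename, translateVars, ← AlgHom.comp_apply, comp_aeval]
    congr 2
    ext1 i
    simp
  simp only [coe_basisMonomials, LinearMap.comp_apply, AlgHom.toLinearMap_apply]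
  rw [hd, map_mul, hl, hr, En_rename_mul_rename, En_rename_mul_rename, iteratedPDeriv_translateVars]

open MvPolynomial in
theorem Fn_translateRight {n : ℕ} (c : Fin n → ℂ) (p : MvPolynomial (Fin n ⊕ Fin n) ℂ) :
    Fn n (translateRight c p) = eval c (En n p) := by
  rw [Fn, LinearMap.comp_apply, En_translateRight, AlgHom.toLinearMap_apply, translateVars,
    ← AlgHom.comp_apply, comp_aeval]
  simp only [map_add, aeval_X, aeval_C, zero_add]
  exact congrArg (fun φ => φ (En n p)) (coe_aeval_eq_eval c)

open MvPolynomial in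
theorem MvPolynomial.eq_zero_of_eval_zero_on_nonempty_interior {n : ℕ}
    {p : MvPolynomial (Fin n) ℂ} {S : Set (Fin n → ℂ)} (hS : (interior S).Nonempty)
    (hp : ∀ x ∈ S, eval x p = 0) : p = 0 := by
  obtain ⟨x, hx⟩ := hS
  obtain ⟨ε, hε, hball⟩ := Metric.isOpen_iff.mp isOpen_interior x hx
  refine funext_set (fun i => Metric.ball (x i) ε)
    (fun i => infinite_of_mem_nhds (x i) (Metric.ball_mem_nhds (x i) hε)) fun y hy => ?_
  rw [hp y (interior_subset (hball ?_)), map_zero]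
  rw [ball_pi x hε]
  exact hy

/-- if `Ker Fₙ` is an MZ space of `ℂ[w,z]`, then so is `Ker Eₙ`. -/
theorem ker_Fn_MZ_implies_ker_En_MZ (n : ℕ)
    (h : IsMZSpace (↑(LinearMap.ker (Fn n)) : Set (MvPolynomial (Fin n ⊕ Fin n) ℂ))) :
    IsMZSpace (↑(LinearMap.ker (En n)) : Set (MvPolynomial (Fin n ⊕ Fin n) ℂ)) := by
  refine ⟨⟨_, rfl⟩, fun f hf g => ?_⟩
  simp only [SetLike.mem_coe, LinearMap.mem_ker] at hf ⊢
  have hpt (c : Fin n → ℂ) : ∃ N : ℕ, ∀ m, N ≤ m →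
      MvPolynomial.eval c (En n (f ^ m * g)) = 0 := by
    obtain ⟨N, hN⟩ := h.2 (translateRight c f) (fun m hm => by
      rw [SetLike.mem_coe, LinearMap.mem_ker, ← map_pow, Fn_translateRight, hf m hm, map_zero])
      (translateRight c g)
    refine ⟨N, fun m hm => ?_⟩
    have := hN m hm
    rwa [SetLike.mem_coe, LinearMap.mem_ker, ← map_pow, ← map_mul, Fn_translateRight] at this
  let S (N : ℕ) : Set (Fin n → ℂ) :=
    {c | ∀ m, N ≤ m → MvPolynomial.eval c (En n (f ^ m * g)) = 0}
  have hclosed (N : ℕ) : IsClosed (S N) := by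
    simp only [S, Set.ofPred_forall]
    exact isClosed_iInter fun m => isClosed_iInter fun _ =>
      isClosed_eq (MvPolynomial.continuous_eval _) continuous_const
  obtain ⟨N, hN⟩ := nonempty_interior_of_iUnion_of_closed hclosed
    (Set.eq_univ_of_forall fun c => Set.mem_iUnion.mpr (hpt c))
  exact ⟨N, fun m hm => MvPolynomial.eq_zero_of_eval_zero_on_nonempty_interior hN
    fun c hc => hc m hm⟩
end

section
/- Let n ≥ 1 and α, β ∈ ℕⁿ. Then ∫_{ℝ²ⁿ} ∏_{j=1}^{n} ((xⱼ − i·yⱼ)/√2)^{αⱼ} · ((xⱼ + i·yⱼ)/√2)^{βⱼ} dγ₂ₙ(x,y) equals α! if α = β, and equals 0 if α ≠ β, where α! = α₁!⋯αₙ!. -/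
open MeasureTheory ProbabilityTheory

lemma integral_pow_odd_mul_exp_neg_sq_half (a : ℕ) :
    ∫ r in Set.Ioi (0 : ℝ), r ^ (2 * a + 1) * Real.exp (-(r ^ 2 / 2)) = 2 ^ a * a.factorial := by
  have h := integral_rpow_mul_exp_neg_mul_rpow (p := 2) (q := (2 * a + 1 : ℕ)) (b := 1 / 2)
    (by norm_num) (by linarith [(Nat.cast_nonneg (2 * a + 1) : (0 : ℝ) ≤ _)]) (by norm_num)
  have e : (((2 * a + 1 : ℕ) : ℝ) + 1) / 2 = a + 1 := by push_cast; ring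
  rw [neg_div, e, Real.Gamma_nat_eq_factorial, one_div, Real.inv_rpow zero_le_two,
    Real.rpow_neg zero_le_two, inv_inv, Real.rpow_add_one two_ne_zero, Real.rpow_natCast] at h
  calc
    _ = ∫ r in Set.Ioi (0 : ℝ), r ^ ((2 * a + 1 : ℕ) : ℝ) * Real.exp (-2⁻¹ * r ^ (2 : ℝ)) := by
      congr 1 with r
      rw [Real.rpow_natCast, Real.rpow_two]
      congr 2
      ring
    _ = _ := by rw [h]; ring

lemma integral_exp_int_mul_I (k : ℤ) :
    ∫ θ in Set.Ioo (-Real.pi) Real.pi, Complex.exp (k * Complex.I * (θ : ℂ)) =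
      if k = 0 then 2 * (Real.pi : ℂ) else 0 := by
  rw [← integral_Ioc_eq_integral_Ioo,
    ← intervalIntegral.integral_of_le (by linarith [Real.pi_pos])]
  split_ifs with h
  · simp [h]
    ring
  · have hk : (k : ℂ) * Complex.I ≠ 0 := by simp [h]
    rw [integral_exp_mul_complex hk, div_eq_zero_iff, sub_eq_zero]
    left
    rw [Complex.exp_eq_exp_iff_exists_int]
    exact ⟨k, by push_cast; ring⟩

lemma integral_gaussianReal_prod_eq_integral_polar (f : ℝ × ℝ → ℂ) :
    ∫ p, f p ∂((gaussianReal 0 1).prod (gaussianReal 0 1)) =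
      ∫ p in Set.Ioi (0 : ℝ) ×ˢ Set.Ioo (-Real.pi) Real.pi,
        ((p.1 * Real.exp (-(p.1 ^ 2 / 2)) / (2 * Real.pi) : ℝ) : ℂ) *
          f (p.1 * Real.cos p.2, p.1 * Real.sin p.2) := by
  rw [gaussianReal_of_var_ne_zero 0 one_ne_zero,
    prod_withDensity (measurable_gaussianPDF _ _) (measurable_gaussianPDF _ _),
    integral_withDensity_eq_integral_toReal_smul (by fun_prop)
      (ae_of_all _ fun _ ↦ ENNReal.mul_lt_top gaussianPDF_lt_top gaussianPDF_lt_top),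
    ← Measure.volume_eq_prod, ← integral_comp_polarCoord_symm]
  congr 1 with p
  simp only [polarCoord_symm_apply, ENNReal.toReal_mul, toReal_gaussianPDF, Complex.real_smul,
    ← mul_assoc, ← Complex.ofReal_mul]
  congr 2
  have hs : √(2 * Real.pi) * √(2 * Real.pi) = 2 * Real.pi :=
    Real.mul_self_sqrt (by positivity)
  have he : Real.exp (-(p.1 * Real.cos p.2) ^ 2 / 2) * Real.exp (-(p.1 * Real.sin p.2) ^ 2 / 2) =
      Real.exp (-(p.1 ^ 2 / 2)) := by
    rw [← Real.exp_add]
    congr 1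
    linear_combination (-p.1 ^ 2 / 2) * Real.sin_sq_add_cos_sq p.2
  simp only [gaussianPDFReal, NNReal.coe_one, mul_one, sub_zero]
  rw [← he]
  generalize √(2 * Real.pi) = s at hs ⊢
  rw [← hs]
  field_simp

lemma integral_gaussianReal_prod_conj_pow_mul_pow (a b : ℕ) :
    ∫ p : ℝ × ℝ, ((((p.1 : ℂ) - Complex.I * (p.2 : ℂ)) / Real.sqrt 2) ^ a *
        ((((p.1 : ℂ) + Complex.I * (p.2 : ℂ)) / Real.sqrt 2) ^ b))
      ∂((gaussianReal 0 1).prod (gaussianReal 0 1)) =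
      if a = b then (a.factorial : ℂ) else 0 := by
  rw [integral_gaussianReal_prod_eq_integral_polar]
  have key (p : ℝ × ℝ) :
      ((p.1 * Real.exp (-(p.1 ^ 2 / 2)) / (2 * Real.pi) : ℝ) : ℂ) *
        (((((p.1 * Real.cos p.2 : ℝ) : ℂ) - Complex.I * ((p.1 * Real.sin p.2 : ℝ) : ℂ)) /
            Real.sqrt 2) ^ a *
          ((((p.1 * Real.cos p.2 : ℝ) : ℂ) + Complex.I * ((p.1 * Real.sin p.2 : ℝ) : ℂ)) /
            Real.sqrt 2) ^ b) =
      ((p.1 ^ (a + b + 1) * Real.exp (-(p.1 ^ 2 / 2)) / (2 * Real.pi * √2 ^ (a + b)) : ℝ) : ℂ) *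
        Complex.exp (((b - a : ℤ) : ℂ) * Complex.I * (p.2 : ℂ)) := by
    have h1 : ((p.1 * Real.cos p.2 : ℝ) : ℂ) - Complex.I * ((p.1 * Real.sin p.2 : ℝ) : ℂ) =
        p.1 * Complex.exp (-p.2 * Complex.I) := by
      rw [Complex.exp_mul_I, Complex.cos_neg, Complex.sin_neg]
      push_cast
      ring
    have h2 : ((p.1 * Real.cos p.2 : ℝ) : ℂ) + Complex.I * ((p.1 * Real.sin p.2 : ℝ) : ℂ) =
        p.1 * Complex.exp (p.2 * Complex.I) := by
      rw [Complex.exp_mul_I]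
      push_cast
      ring
    have h3 : Complex.exp (((b - a : ℤ) : ℂ) * Complex.I * (p.2 : ℂ)) =
        Complex.exp (-p.2 * Complex.I) ^ a * Complex.exp (p.2 * Complex.I) ^ b := by
      rw [← Complex.exp_nat_mul, ← Complex.exp_nat_mul, ← Complex.exp_add]
      congr 1
      push_cast
      ring
    rw [h1, h2, h3]
    simp only [div_pow, mul_pow]
    push_cast
    have hs : ((√2 : ℝ) : ℂ) ≠ 0 := by simp
    have hpi : (Real.pi : ℂ) ≠ 0 := by simp [Real.pi_ne_zero]
    field_simp
    ring
  simp only [key]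
  rw [Measure.volume_eq_prod, setIntegral_prod_mul
    (fun r : ℝ ↦ ((r ^ (a + b + 1) * Real.exp (-(r ^ 2 / 2)) /
      (2 * Real.pi * √2 ^ (a + b)) : ℝ) : ℂ))
    (fun θ : ℝ ↦ Complex.exp (((b - a : ℤ) : ℂ) * Complex.I * (θ : ℂ))),
    integral_exp_int_mul_I]
  by_cases h : a = b
  · subst h
    rw [if_pos (sub_self _), if_pos rfl, integral_complex_ofReal, integral_div, ← two_mul,
      integral_pow_odd_mul_exp_neg_sq_half, pow_mul √2, Real.sq_sqrt zero_le_two]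
    have hpi : (Real.pi : ℂ) ≠ 0 := by simp [Real.pi_ne_zero]
    push_cast
    field_simp
  · rw [if_neg (by omega), if_neg h, mul_zero]

/-- the mixed moments of `Wⱼ = (xⱼ - i yⱼ)/√2` and `Zⱼ = (xⱼ + i yⱼ)/√2`
with respect to the standard Gaussian measure on `ℝ²ⁿ` are
`E(W^α Z^β) = α!` if `α = β` and `0` otherwise. -/
theorem gaussian_WZ_moments (n : ℕ) (α β : Fin n → ℕ) :
    (∫ p : (Fin n → ℝ) × (Fin n → ℝ),
        ∏ j : Fin n,
          ((((p.1 j : ℂ) - Complex.I * (p.2 j : ℂ)) / Real.sqrt 2) ^ (α j) *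
            ((((p.1 j : ℂ) + Complex.I * (p.2 j : ℂ)) / Real.sqrt 2) ^ (β j)))
      ∂((Measure.pi fun _ : Fin n => gaussianReal 0 1).prod
          (Measure.pi fun _ : Fin n => gaussianReal 0 1))) =
      if α = β then (∏ j : Fin n, ((α j).factorial : ℂ)) else 0 := by
  rw [← (measurePreserving_arrowProdEquivProdArrow ℝ ℝ (Fin n) (fun _ ↦ gaussianReal 0 1)
    (fun _ ↦ gaussianReal 0 1)).integral_comp']
  refine (integral_fintype_prod_eq_prod (fun (j : Fin n) (q : ℝ × ℝ) ↦
    (((q.1 : ℂ) - Complex.I * (q.2 : ℂ)) / Real.sqrt 2) ^ (α j) *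
      (((q.1 : ℂ) + Complex.I * (q.2 : ℂ)) / Real.sqrt 2) ^ (β j))).trans ?_
  simp only [integral_gaussianReal_prod_conj_pow_mul_pow]
  split_ifs with h
  · simp [h]
  · obtain ⟨j, hj⟩ := Function.ne_iff.mp h
    exact Finset.prod_eq_zero (Finset.mem_univ j) (if_neg hj)
end

section
/- Let O(n) be the real orthogonal group (real n×n matrices g with gᵀg = I), equipped with its Haar probability measure μ. Assume that the set K = {P ∈ ℂ[x₁,…,xₙ] : for every x ∈ ℝⁿ, ∫_{O(n)} P(g·x) dμ(g) = 0} is an MZ space of ℂ[x₁,…,xₙ]. Then GMC(n) holds for homogeneous polynomials: if P ∈ ℂ[x₁,…,xₙ] is homogeneous and E(Pᵐ) = 0 for all m ≥ 1, then for every Q ∈ ℂ[x₁,…,xₙ] one has E(Pᵐ·Q) = 0 for all sufficiently large m. -/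
open MeasureTheory ProbabilityTheory

/-- We endow the orthogonal group `O(n)` (a compact topological group) with its Borel
`σ`-algebra. -/
noncomputable instance (n : ℕ) :
    MeasurableSpace (Matrix.orthogonalGroup (Fin n) ℝ) := borel _

open Matrix

instance orthogonalGroup_borelSpace (n : ℕ) : BorelSpace (Matrix.orthogonalGroup (Fin n) ℝ) := ⟨rfl⟩

instance orthogonalGroup_secondCountableTopology (n : ℕ) :
    SecondCountableTopology (Matrix.orthogonalGroup (Fin n) ℝ) :=
  haveI : SecondCountableTopology (Matrix (Fin n) (Fin n) ℝ) :=
    inferInstanceAs (SecondCountableTopology (Fin n → Fin n → ℝ))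
  TopologicalSpace.Subtype.secondCountableTopology _

instance orthogonalGroup_compactSpace (n : ℕ) :
    CompactSpace (Matrix.orthogonalGroup (Fin n) ℝ) := by
  apply isCompact_iff_compactSpace.mp
  have hbox : IsCompact (Set.univ.pi fun _ : Fin n => Set.univ.pi fun _ : Fin n =>
      Set.Icc (-1 : ℝ) 1 : Set (Matrix (Fin n) (Fin n) ℝ)) :=
    isCompact_univ_pi fun _ => isCompact_univ_pi fun _ => isCompact_Icc
  refine hbox.of_isClosed_subset ?_ fun U hU i _ j _ =>
    abs_le.mp (entry_norm_bound_of_unitary (𝕜 := ℝ) hU i j)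
  have h : ((Matrix.orthogonalGroup (Fin n) ℝ : Submonoid (Matrix (Fin n) (Fin n) ℝ)) :
      Set (Matrix (Fin n) (Fin n) ℝ)) = {A | A * Aᵀ = 1} := by
    ext A
    exact Matrix.mem_orthogonalGroup_iff _ _
  rw [h]
  exact isClosed_eq (by fun_prop) continuous_const

/-- Two real vectors of the same length are related by an orthogonal matrix. -/
lemma exists_orthogonalGroup_mulVec_eq {n : ℕ} {u v : Fin n → ℝ} (h : u ⬝ᵥ u = v ⬝ᵥ v) :
    ∃ g : Matrix.orthogonalGroup (Fin n) ℝ, (g : Matrix (Fin n) (Fin n) ℝ) *ᵥ u = v := by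
  by_cases huv : u = v
  · exact ⟨1, by simp [huv]⟩
  set w := u - v with hw
  have hs : w ⬝ᵥ w ≠ 0 := fun h0 => huv (sub_eq_zero.mp (dotProduct_self_eq_zero.mp h0))
  have hwu : w ⬝ᵥ w = 2 * (w ⬝ᵥ u) := by
    simp only [hw, sub_dotProduct, dotProduct_sub, dotProduct_comm u v]
    linarith
  refine ⟨⟨1 - (2 / (w ⬝ᵥ w)) • vecMulVec w w, ?_⟩, ?_⟩
  · rw [Matrix.mem_orthogonalGroup_iff]
    simp only [transpose_sub, transpose_one,
      transpose_smul, transpose_vecMulVec, sub_mul, mul_sub, one_mul, mul_one, smul_mul_assoc,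
      mul_smul_comm, vecMulVec_mul_vecMulVec]
    ext i j
    simp [vecMulVec_apply]
    field_simp
    ring
  · have : w ⬝ᵥ u ≠ 0 := fun h0 => hs (by rw [hwu, h0, mul_zero])
    simp only [sub_mulVec, one_mulVec, smul_mulVec, vecMulVec_mulVec]
    rw [hwu]
    ext i
    have hi : w i = u i - v i := rfl
    simp only [Pi.sub_apply, Pi.smul_apply, smul_eq_mul, MulOpposite.smul_eq_mul_unop,
      MulOpposite.unop_op, hi]
    field_simp
    ring

/-- The standard Gaussian measure is invariant under orthogonal matrices. -/
lemma measurePreserving_mulVec_pi_gaussianReal {n : ℕ}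
    (g : Matrix.orthogonalGroup (Fin n) ℝ) :
    MeasurePreserving (fun x : Fin n → ℝ => (g : Matrix (Fin n) (Fin n) ℝ) *ᵥ x)
      (Measure.pi fun _ => gaussianReal 0 1) (Measure.pi fun _ => gaussianReal 0 1) := by
  refine ⟨by fun_prop, ?_⟩
  have hg : (g : Matrix (Fin n) (Fin n) ℝ)ᵀ * g = 1 :=
    (Matrix.mem_orthogonalGroup_iff' _ _).mp g.2
  let f : EuclideanSpace ℝ (Fin n) →ₗᵢ[ℝ] EuclideanSpace ℝ (Fin n) :=
    { Matrix.toEuclideanLin (g : Matrix (Fin n) (Fin n) ℝ) with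
      norm_map' := fun x => by
        rw [← sq_eq_sq₀ (norm_nonneg _) (norm_nonneg _), ← real_inner_self_eq_norm_sq,
          ← real_inner_self_eq_norm_sq]
        simp only [EuclideanSpace.inner_eq_star_dotProduct, star_trivial]
        change (g.1 *ᵥ x.ofLp) ⬝ᵥ (g.1 *ᵥ x.ofLp) = _
        rw [dotProduct_mulVec, vecMul_mulVec, hg, vecMul_one] }
  have hf : ⇑f = ⇑(f.toLinearIsometryEquiv rfl) := rfl
  have h := stdGaussian_map (f.toLinearIsometryEquiv rfl)
  rw [← hf, ← map_pi_eq_stdGaussian, Measure.map_map (by fun_prop) (by fun_prop)] at h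
  have h2 := congrArg (Measure.map (WithLp.ofLp : EuclideanSpace ℝ (Fin n) → Fin n → ℝ)) h
  rw [Measure.map_map (by fun_prop) (by fun_prop), Measure.map_map (by fun_prop) (by fun_prop)]
    at h2
  exact h2.trans Measure.map_id

lemma integrable_pow_norm_toLp_pi_gaussianReal (n k : ℕ) :
    Integrable (fun x : Fin n → ℝ => ‖WithLp.toLp 2 x‖ ^ k)
      (Measure.pi fun _ => gaussianReal 0 1) := by
  have h := (IsGaussian.memLp_id (stdGaussian (EuclideanSpace ℝ (Fin n))) k
    (by simp)).integrable_norm_pow'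
  rw [← map_pi_eq_stdGaussian] at h
  exact h.comp_measurable (by fun_prop)

lemma integrable_eval_pi_gaussianReal {n : ℕ} (P : MvPolynomial (Fin n) ℂ) :
    Integrable (fun x : Fin n → ℝ => MvPolynomial.eval (fun i => (x i : ℂ)) P)
      (Measure.pi fun _ => gaussianReal 0 1) := by
  induction P using MvPolynomial.induction_on' with
  | add p q hp hq =>
    simp only [map_add]
    exact hp.add hq
  | monomial s a =>
    simp only [MvPolynomial.eval_monomial, Finsupp.prod_fintype _ _ (fun _ => pow_zero _)]
    refine Integrable.const_mul (Integrable.fintype_prod (𝕜 := ℂ)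
      (f := fun i (t : ℝ) => (t : ℂ) ^ s i) fun i => ?_) a
    have h := (memLp_id_gaussianReal' (μ := 0) (v := 1) (s i : ENNReal)
      (by simp)).integrable_norm_pow'
    refine h.mono' (by fun_prop) (.of_forall fun t => ?_)
    simp

/-- The Reynolds operator of `O(n)`, as a function on `ℝⁿ`. -/
noncomputable def reynolds {n : ℕ} (μ : Measure (Matrix.orthogonalGroup (Fin n) ℝ))
    (P : MvPolynomial (Fin n) ℂ) (x : Fin n → ℝ) : ℂ :=
  ∫ g : Matrix.orthogonalGroup (Fin n) ℝ,
    MvPolynomial.eval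
      (fun k => (((g : Matrix (Fin n) (Fin n) ℝ) *ᵥ x) k : ℂ)) P ∂μ

section reynolds

variable {n : ℕ} {μ : Measure (Matrix.orthogonalGroup (Fin n) ℝ)}

lemma integral_reynolds [IsProbabilityMeasure μ] (P : MvPolynomial (Fin n) ℂ) :
    ∫ x, reynolds μ P x ∂(Measure.pi fun _ => gaussianReal 0 1) = gaussExp P := by
  have hcont : Continuous fun p : Matrix.orthogonalGroup (Fin n) ℝ × (Fin n → ℝ) =>
      MvPolynomial.eval (fun k => (((p.1 : Matrix (Fin n) (Fin n) ℝ) *ᵥ p.2) k : ℂ)) P := by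
    refine (MvPolynomial.continuous_eval P).comp (continuous_pi fun k => ?_)
    have h : Continuous fun p : Matrix.orthogonalGroup (Fin n) ℝ × (Fin n → ℝ) =>
        (p.1 : Matrix (Fin n) (Fin n) ℝ) *ᵥ p.2 :=
      Continuous.matrix_mulVec (by fun_prop) (by fun_prop)
    exact Complex.continuous_ofReal.comp (continuous_pi_iff.mp h k)
  have hP : Continuous fun x : Fin n → ℝ => MvPolynomial.eval (fun i => (x i : ℂ)) P :=
    (MvPolynomial.continuous_eval P).comp (by fun_prop)
  have hint := integrable_eval_pi_gaussianReal P
  have hi : Integrable (Function.uncurry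
      fun (g : Matrix.orthogonalGroup (Fin n) ℝ) (x : Fin n → ℝ) =>
        MvPolynomial.eval (fun k => (((g : Matrix (Fin n) (Fin n) ℝ) *ᵥ x) k : ℂ)) P)
      (μ.prod (Measure.pi fun _ => gaussianReal 0 1)) := by
    refine (integrable_prod_iff hcont.aestronglyMeasurable).mpr ⟨.of_forall fun g =>
      (measurePreserving_mulVec_pi_gaussianReal g).integrable_comp_of_integrable hint, ?_⟩
    have (g : Matrix.orthogonalGroup (Fin n) ℝ) :=
      integral_map (μ := Measure.pi fun _ : Fin n => gaussianReal 0 1)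
        (measurePreserving_mulVec_pi_gaussianReal g).measurable.aemeasurable
        (hP.norm.aestronglyMeasurable)
    simp only [(measurePreserving_mulVec_pi_gaussianReal _).map_eq] at this
    refine (integrable_const (∫ x : Fin n → ℝ, ‖MvPolynomial.eval (fun i => (x i : ℂ)) P‖
      ∂(Measure.pi fun _ => gaussianReal 0 1))).congr (.of_forall fun g => this g)
  have hg (g : Matrix.orthogonalGroup (Fin n) ℝ) :=
    integral_map (μ := Measure.pi fun _ : Fin n => gaussianReal 0 1)
      (measurePreserving_mulVec_pi_gaussianReal g).measurable.aemeasurable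
      hP.aestronglyMeasurable
  simp only [(measurePreserving_mulVec_pi_gaussianReal _).map_eq] at hg
  simp only [reynolds]
  rw [← integral_integral_swap hi]
  simp only [← hg]
  simp [gaussExp]

lemma reynolds_mulVec [μ.IsMulRightInvariant] (P : MvPolynomial (Fin n) ℂ)
    (h : Matrix.orthogonalGroup (Fin n) ℝ) (x : Fin n → ℝ) :
    reynolds μ P ((h : Matrix (Fin n) (Fin n) ℝ) *ᵥ x) = reynolds μ P x := by
  rw [reynolds, reynolds, ← integral_mul_right_eq_self (fun g : Matrix.orthogonalGroup (Fin n) ℝ =>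
    MvPolynomial.eval (fun k => (((g : Matrix (Fin n) (Fin n) ℝ) *ᵥ x) k : ℂ)) P) h]
  simp only [Matrix.mulVec_mulVec, Submonoid.coe_mul]

lemma reynolds_smul {P : MvPolynomial (Fin n) ℂ} {k : ℕ} (hP : P.IsHomogeneous k)
    (c : ℝ) (x : Fin n → ℝ) : reynolds μ P (c • x) = (c : ℂ) ^ k * reynolds μ P x := by
  rw [reynolds, reynolds, ← integral_const_mul]
  congr 1 with g
  simp only [Matrix.mulVec_smul, Pi.smul_apply, smul_eq_mul, Complex.ofReal_mul,
    MvPolynomial.eval_eq, Finset.mul_sum, mul_pow, Finset.prod_mul_distrib]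
  refine Finset.sum_congr rfl fun s hs => ?_
  rw [Finset.prod_pow_eq_pow_sum, ← hP.degree_eq_sum_deg_support hs]
  ring

lemma norm_pow_mul_reynolds_comm [μ.IsMulRightInvariant] {P : MvPolynomial (Fin n) ℂ} {k : ℕ}
    (hP : P.IsHomogeneous k) (x y : Fin n → ℝ) :
    ((‖WithLp.toLp 2 y‖ ^ k : ℝ) : ℂ) * reynolds μ P x =
      ((‖WithLp.toLp 2 x‖ ^ k : ℝ) : ℂ) * reynolds μ P y := by
  push_cast
  rw [← reynolds_smul hP, ← reynolds_smul hP]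
  have hsq (z : Fin n → ℝ) : z ⬝ᵥ z = ‖WithLp.toLp 2 z‖ ^ 2 := by
    rw [EuclideanSpace.real_norm_sq_eq]
    simp [dotProduct, sq]
  obtain ⟨h, hh⟩ := exists_orthogonalGroup_mulVec_eq
    (u := ‖WithLp.toLp 2 y‖ • x) (v := ‖WithLp.toLp 2 x‖ • y) (by
      simp only [smul_dotProduct, dotProduct_smul, smul_eq_mul]
      rw [hsq, hsq]
      ring)
  rw [← hh, reynolds_mulVec]

/-- A homogeneous polynomial of Gaussian expectation zero lies in the kernel of the Reynolds
operator. -/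
lemma reynolds_eq_zero_of_gaussExp_eq_zero [IsProbabilityMeasure μ] [μ.IsMulRightInvariant]
    {P : MvPolynomial (Fin n) ℂ} {k : ℕ} (hP : P.IsHomogeneous k) (h : gaussExp P = 0)
    (x : Fin n → ℝ) : reynolds μ P x = 0 := by
  rcases Nat.eq_zero_or_pos n with rfl | hn
  · have h2 := integral_reynolds (μ := μ) P
    rw [h] at h2
    simpa [Subsingleton.elim _ x] using h2
  have : Nonempty (Fin n) := ⟨⟨0, hn⟩⟩
  have key : ((∫ y : Fin n → ℝ, ‖WithLp.toLp 2 y‖ ^ k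
      ∂(Measure.pi fun _ => gaussianReal 0 1) : ℝ) : ℂ) * reynolds μ P x = 0 := by
    rw [← integral_complex_ofReal, ← integral_mul_const]
    simp only [norm_pow_mul_reynolds_comm hP x]
    rw [integral_const_mul, integral_reynolds, h, mul_zero]
  refine (mul_eq_zero.mp key).resolve_left fun h0 => ?_
  rw [Complex.ofReal_eq_zero, integral_eq_zero_iff_of_nonneg (fun y => by positivity)
    (integrable_pow_norm_toLp_pi_gaussianReal n k)] at h0
  have hne : ∀ᵐ y : Fin n → ℝ ∂(Measure.pi fun _ => gaussianReal 0 1), y ≠ 0 := by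
    have := nullSingletonClass_gaussianReal (μ := 0) one_ne_zero
    have := Measure.pi_nullSingletonClass' (μ := fun _ : Fin n => gaussianReal 0 1)
    exact Measure.ae_ne _ _
  obtain ⟨y, hy0, hy⟩ := (h0.and hne).exists
  exact hy ((WithLp.toLp_eq_zero 2).mp (norm_eq_zero.mp (eq_zero_of_pow_eq_zero hy0)))

end reynolds

/-- if the kernel of the Reynolds operator of `O(n)` acting on
`ℂ[x₁,…,xₙ]` is an MZ space, then GMC(n) holds for homogeneous polynomials. -/
theorem gmc_homogeneous_of_reynolds_MZ (n : ℕ)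
    (μ : Measure (Matrix.orthogonalGroup (Fin n) ℝ))
    (hμ : μ.IsHaarMeasure) (hμprob : IsProbabilityMeasure μ)
    (hK : IsMZSpace {P : MvPolynomial (Fin n) ℂ | ∀ x : Fin n → ℝ,
      (∫ g : Matrix.orthogonalGroup (Fin n) ℝ,
        MvPolynomial.eval
          (fun k => ((Matrix.mulVec (g : Matrix (Fin n) (Fin n) ℝ) x k : ℝ) : ℂ)) P ∂μ) = 0})
    (P : MvPolynomial (Fin n) ℂ) (hP : ∃ d : ℕ, P.IsHomogeneous d)
    (hPm : ∀ m : ℕ, 1 ≤ m → gaussExp (P ^ m) = 0) :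
    ∀ Q : MvPolynomial (Fin n) ℂ, ∃ N : ℕ, ∀ m : ℕ, N ≤ m →
      gaussExp (P ^ m * Q) = 0 := by
  obtain ⟨d, hd⟩ := hP
  have hright : μ.IsMulRightInvariant := ⟨fun g => by
    have := Measure.isProbabilityMeasure_map (μ := μ) (measurable_mul_const g).aemeasurable
    exact Measure.isHaarMeasure_eq_of_isProbabilityMeasure _ _⟩
  intro Q
  obtain ⟨N, hN⟩ := hK.2 P (fun m hm x =>
    reynolds_eq_zero_of_gaussExp_eq_zero (μ := μ) (hd.pow m) (hPm m hm) x) Q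
  refine ⟨N, fun m hm => ?_⟩
  rw [← integral_reynolds (μ := μ)]
  exact integral_eq_zero_of_ae (.of_forall (hN m hm))
end

section
/- Let P ∈ ℂ[x,y] be a homogeneous polynomial in two variables such that E(Pᵐ) = 0 for all m ≥ 1 (Gaussian expectation with respect to γ₂). Then for every Q ∈ ℂ[x,y] one has E(Pᵐ·Q) = 0 for all sufficiently large m. -/
open MeasureTheory ProbabilityTheory

open Polynomial in
/-- Over `k⟦t⟧`, the polynomial `X ^ r - t f` splits off a monic factor of degree `r` which
reduces to `X ^ r` modulo `t`, with a cofactor reducing to `1`. -/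
lemma exists_monic_factor_X_pow_sub {k : Type*} [Field k] (r : ℕ) (f : k[X]) :
    ∃ A B : (PowerSeries k)[X], A.Monic ∧ A.natDegree = r ∧
      A.map PowerSeries.constantCoeff = X ^ r ∧ B.map PowerSeries.constantCoeff = 1 ∧
      A * B = X ^ r - C PowerSeries.X * f.map PowerSeries.C := by
  set G : (PowerSeries k)[X] := X ^ r - C PowerSeries.X * f.map PowerSeries.C with hG
  have hmap : G.map PowerSeries.constantCoeff = X ^ r := by simp [hG]
  have hI : IsLocalRing.maximalIdeal (PowerSeries k) = Ideal.span {PowerSeries.X} :=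
    PowerSeries.maximalIdeal_eq_span_X
  have hres : ∀ x : PowerSeries k, IsLocalRing.residue (PowerSeries k) x =
      IsLocalRing.residue (PowerSeries k) (PowerSeries.C (PowerSeries.constantCoeff x)) := by
    intro x
    rw [← sub_eq_zero, ← map_sub, IsLocalRing.residue_eq_zero_iff, hI,
      Ideal.mem_span_singleton, PowerSeries.X_dvd_iff]
    simp
  have hGres : (G : PowerSeries (PowerSeries k)).map (IsLocalRing.residue _) =
      PowerSeries.X ^ r := by
    ext n
    have h := congrArg (fun q : k[X] => q.coeff n) hmap
    simp only [coeff_map] at h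
    rw [PowerSeries.coeff_map, Polynomial.coeff_coe, hres, h, PowerSeries.coeff_X_pow, coeff_X_pow]
    split_ifs <;> simp
  have hne : (G : PowerSeries (PowerSeries k)).map (IsLocalRing.residue _) ≠ 0 := by
    rw [hGres]; exact pow_ne_zero _ PowerSeries.X_ne_zero
  have : IsAdicComplete (IsLocalRing.maximalIdeal (PowerSeries k)) (PowerSeries k) := by
    rw [hI]; infer_instance
  obtain ⟨A, h, H⟩ := PowerSeries.exists_isWeierstrassFactorization hne
  have hdeg : A.natDegree = r := by
    rw [H.natDegree_eq_toNat_order_map, hGres, PowerSeries.order_X_pow]; simp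
  have hmon := H.isDistinguishedAt.monic
  have hA : A.map PowerSeries.constantCoeff = X ^ r := by
    ext n
    rw [coeff_map, coeff_X_pow]
    rcases lt_trichotomy n r with hn | hn | hn
    · have := H.isDistinguishedAt.mem (hdeg ▸ hn)
      rw [hI, Ideal.mem_span_singleton, PowerSeries.X_dvd_iff] at this
      rw [this, if_neg hn.ne]
    · rw [if_pos hn, hn, ← hdeg, hmon.coeff_natDegree, map_one]
    · rw [coeff_eq_zero_of_natDegree_lt (hdeg ▸ hn), if_neg hn.ne', map_zero]
  have hdvd : A ∣ G := by
    rw [← modByMonic_eq_zero_iff_dvd hmon]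
    have hord : ((A : PowerSeries (PowerSeries k)).map (Ideal.Quotient.mk
        (IsLocalRing.maximalIdeal (PowerSeries k)))).order.toNat = A.natDegree := by
      have := H.isDistinguishedAt.coe_natDegree_eq_order_map A 1
        (by rw [map_one, ← Ideal.ne_top_iff_one]; exact Ideal.IsPrime.ne_top') (by simp)
      rw [← this]; rfl
    refine (PowerSeries.IsWeierstrassDivisorAt.eq_zero_of_mul_eq
      (H.isDistinguishedAt.isWeierstrassDivisorAt') (q := h - (G /ₘ A : (PowerSeries k)[X]))
      (r := G %ₘ A) ?_ ?_).2
    · rw [hord, ← degree_eq_natDegree hmon.ne_zero]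
      exact degree_modByMonic_lt _ hmon
    · rw [mul_sub, ← H.eq_mul, ← coe_mul, ← coe_sub]
      congr 1
      rw [sub_eq_iff_eq_add]
      exact (modByMonic_add_div G A).symm
  obtain ⟨B, hB⟩ := hdvd
  refine ⟨A, B, hmon, hdeg, hA, ?_, hB.symm⟩
  have h2 := congrArg (Polynomial.map PowerSeries.constantCoeff) hB
  rw [hmap, Polynomial.map_mul, hA] at h2
  exact mul_left_cancel₀ (pow_ne_zero r X_ne_zero) (by rw [← h2, mul_one])

open Polynomial in
/-- A monic divisor of `X ^ r - t f` over `k((t))` cannot have constant coefficient `- t f(0)`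
when `0 < r < deg f` and `f(0) ≠ 0`: that coefficient is integral over `k[t⁻¹]`. -/
lemma coeff_zero_ne_of_dvd {k : Type*} [Field k] {r : ℕ} {f : k[X]}
    (hr : r < f.natDegree) (hf : f.coeff 0 ≠ 0) {A : (PowerSeries k)[X]} (hA : A.Monic)
    (hdvd : A ∣ X ^ r - C PowerSeries.X * f.map PowerSeries.C) :
    A.coeff 0 ≠ - (PowerSeries.X * PowerSeries.C (f.coeff 0)) := by
  intro h0
  set ι : PowerSeries k →+* LaurentSeries k := HahnSeries.ofPowerSeries ℤ k with hι
  set u : LaurentSeries k := HahnSeries.single (-1) 1 with hu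
  have htu : ι PowerSeries.X * u = 1 := by
    rw [hι, HahnSeries.ofPowerSeries_X, hu, HahnSeries.single_mul_single]; simp
  let _ : Algebra k[X] (LaurentSeries k) := (aeval u).toAlgebra
  have halg : ∀ q : k[X], algebraMap k[X] (LaurentSeries k) q = aeval u q := fun _ => rfl
  have hC : ∀ a : k, algebraMap k (LaurentSeries k) a = HahnSeries.C a := fun a => by
    simp [HahnSeries.algebraMap_apply']
  have hιC : ∀ a : k, ι (PowerSeries.C a) = HahnSeries.C a := fun a => by
    simp [hι]
  have hf0 : f ≠ 0 := by rintro rfl; simp at hf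
  have hl : f.leadingCoeff ≠ 0 := leadingCoeff_ne_zero.2 hf0
  set p : k[X][X] := C (C f.leadingCoeff⁻¹) * (f.map C - C X * X ^ r) with hp
  have hpm : p.Monic := by
    have h1 : (f.map C - C X * X ^ r : k[X][X]).natDegree = f.natDegree := by
      rw [natDegree_sub_eq_left_of_natDegree_lt, natDegree_map_eq_of_injective C_injective]
      rw [natDegree_map_eq_of_injective C_injective]
      exact (natDegree_C_mul_X_pow_le _ _).trans_lt hr
    rw [Monic, hp, leadingCoeff_C_mul_of_isUnit (by simpa using hl),
      ← coeff_natDegree (p := (_ - _ : k[X][X])), h1, coeff_sub,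
      coeff_map, coeff_C_mul, coeff_X_pow, if_neg hr.ne', mul_zero, sub_zero, coeff_natDegree,
      ← C_mul, inv_mul_cancel₀ hl, C_1]
  have hpA : A.map ι ∣ p.map (algebraMap k[X] (LaurentSeries k)) := by
    have h1 := Polynomial.map_dvd ι hdvd
    have h2 : p.map (algebraMap k[X] (LaurentSeries k)) =
        (X ^ r - C PowerSeries.X * f.map PowerSeries.C : (PowerSeries k)[X]).map ι *
        C (- (u * algebraMap k (LaurentSeries k) f.leadingCoeff⁻¹)) := by
      have h3 : (algebraMap k[X] (LaurentSeries k)).comp C = ι.comp PowerSeries.C := by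
        ext x : 1
        simp [halg, hC, hιC]
      have h4 : algebraMap k[X] (LaurentSeries k) (C f.leadingCoeff⁻¹) =
          algebraMap k (LaurentSeries k) f.leadingCoeff⁻¹ := by rw [halg, aeval_C]
      have h5 : algebraMap k[X] (LaurentSeries k) X = u := by rw [halg, aeval_X]
      rw [hp]
      simp only [Polynomial.map_mul, Polynomial.map_sub, Polynomial.map_pow, map_X, map_C, map_map,
        h3, h4, h5, C_neg, C_mul]
      have h6 : (C (ι PowerSeries.X) * C u : (LaurentSeries k)[X]) = 1 := by
        rw [← C_mul, htu, C_1]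
      linear_combination (- C (algebraMap k (LaurentSeries k) f.leadingCoeff⁻¹) *
        f.map (ι.comp PowerSeries.C)) * h6
    rw [h2]
    exact h1.mul_right _
  have hintegral := isIntegral_coeff_of_dvd p (A.map ι) hpm (hA.map ι) hpA 0
  rw [coeff_map, h0] at hintegral
  have hintegral2 : IsIntegral k[X] (ι PowerSeries.X) := by
    have h1 := hintegral.mul (isIntegral_algebraMap (R := k[X]) (x := C (-(f.coeff 0)⁻¹)))
    have h2 : ι PowerSeries.X = ι (-(PowerSeries.X * PowerSeries.C (f.coeff 0))) *
        algebraMap k[X] (LaurentSeries k) (C (-(f.coeff 0)⁻¹)) := by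
      rw [halg, aeval_C, hC, map_neg, map_neg, map_mul, hιC, neg_mul_neg, mul_assoc, ← map_mul,
        mul_inv_cancel₀ hf, map_one, mul_one]
    rw [h2]
    exact h1
  obtain ⟨q, hqm, hq⟩ := hintegral2
  have hrev : eval₂ (algebraMap k[X] (LaurentSeries k)) u q.reverse = 0 := by
    let _ : Invertible (ι PowerSeries.X) := ⟨u, by rw [mul_comm, htu], htu⟩
    have h := eval₂_reverse_mul_pow (algebraMap k[X] (LaurentSeries k)) (ι PowerSeries.X) q
    rw [hq] at h
    exact (mul_eq_zero.1 h).resolve_right (pow_ne_zero _ (left_ne_zero_of_mul_eq_one htu))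
  rw [← divX_mul_X_add q.reverse, coeff_zero_reverse, hqm.leadingCoeff, eval₂_add, eval₂_mul,
    eval₂_X, eval₂_C, map_one] at hrev
  set s : k[X] := q.reverse.divX.eval X with hs
  have h1 : aeval u (s * X) + 1 = 0 := by
    rw [← hrev, map_mul, aeval_X, hs, ← halg, eval, hom_eval₂, RingHom.comp_id, halg, aeval_X]
  have hcoeff : ∀ s : k[X], (aeval u (s * X)).coeff 0 = 0 := by
    intro s
    induction s using Polynomial.induction_on' with
    | add a b ha hb => rw [add_mul, map_add, HahnSeries.coeff_add, ha, hb, add_zero]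
    | monomial n a =>
      rw [← monomial_one_one_eq_X, monomial_mul_monomial, aeval_monomial, hu,
        HahnSeries.single_pow, hC, HahnSeries.C_mul_eq_smul, HahnSeries.coeff_smul,
        HahnSeries.coeff_single_of_ne, smul_zero]
      simp
      omega
  have h2 := congrArg (fun x : LaurentSeries k => x.coeff 0) h1
  rw [HahnSeries.coeff_add, hcoeff] at h2
  simp at h2

/-- The formal derivative commutes with coefficientwise maps. -/
lemma PowerSeries.derivative_map_apply {R S : Type*} [CommRing R] [CommRing S] (φ : R →+* S)
    (x : PowerSeries R) :
    PowerSeries.derivative S (x.map φ) = (PowerSeries.derivative R x).map φ := by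
  ext n
  simp [PowerSeries.coeff_derivative]

lemma coeff_toLaurent_natCast {R : Type*} [Semiring R] (q : Polynomial R) (n : ℕ) :
    (Polynomial.toLaurent q).coeff n = q.coeff n :=
  Finsupp.mapDomain_apply Nat.castEmbedding.injective _ n

lemma coeff_toLaurent_of_neg {R : Type*} [Semiring R] (q : Polynomial R) {n : ℤ} (hn : n < 0) :
    (Polynomial.toLaurent q).coeff n = 0 :=
  Finsupp.mapDomain_of_notMem_range _ _ (by rintro ⟨m, rfl⟩; simp at hn; omega)

open Polynomial in
/-- In a factorization `X ^ r - t f = A B` over `k⟦t⟧` with `A` monic of degree `r`, lifting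
`X ^ r · 1`, the logarithmic derivative of `B(0)` is the generating series of the constant terms
of the powers of `X ^ (-r) f`; if these vanish then `B(0) = 1`. -/
lemma coeff_zero_cofactor_eq_one {k : Type*} [Field k] [CharZero k] {r : ℕ} {f : k[X]}
    {A B : (PowerSeries k)[X]} (hAm : A.Monic) (hAd : A.natDegree = r)
    (hA : A.map PowerSeries.constantCoeff = X ^ r) (hB : B.map PowerSeries.constantCoeff = 1)
    (hAB : A * B = X ^ r - C PowerSeries.X * f.map PowerSeries.C)
    (hct : ∀ m : ℕ, 1 ≤ m →
      ((LaurentPolynomial.T (-r) * toLaurent f) ^ m : LaurentPolynomial k).coeff 0 = 0) :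
    B.coeff 0 = 1 := by
  set p : LaurentPolynomial k := LaurentPolynomial.T (-r) * toLaurent f with hp
  let Φ : (PowerSeries k)[X] →+* PowerSeries k[X] :=
    eval₂RingHom (PowerSeries.map C) (PowerSeries.C X)
  let ιp : PowerSeries k[X] →+* PowerSeries (LaurentPolynomial k) := PowerSeries.map toLaurent
  let ιn : PowerSeries k[X] →+* PowerSeries (LaurentPolynomial k) :=
    PowerSeries.map ((LaurentPolynomial.invert (R := k) : _ →+* _).comp toLaurent)
  let ε : PowerSeries k[X] →+* PowerSeries k := PowerSeries.map constantCoeff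
  have hε : ∀ q, ε (Φ q) = q.coeff 0 := by
    intro q
    have h1 : ε.comp Φ = constantCoeff := by
      ext x : 2
      · ext n; simp [ε, Φ]
      · simp [ε, Φ]
    exact congrArg (fun g : (PowerSeries k)[X] →+* PowerSeries k => g q) h1
  have hcc : ∀ q, PowerSeries.constantCoeff (Φ q) = q.map PowerSeries.constantCoeff := by
    intro q
    have h1 : PowerSeries.constantCoeff.comp Φ = mapRingHom PowerSeries.constantCoeff := by
      ext x : 2
      · simp only [Φ, RingHom.comp_apply, coe_eval₂RingHom, eval₂_C, coe_mapRingHom, map_C,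
          ← PowerSeries.coeff_zero_eq_constantCoeff_apply, PowerSeries.coeff_map]
      · simp [Φ]
    exact congrArg (fun g : (PowerSeries k)[X] →+* k[X] => g q) h1
  set α := Φ A.reverse with hα
  set β := Φ B with hβ
  have hεα : ε α = 1 := by rw [hα, hε, coeff_zero_reverse, hAm.leadingCoeff]
  have hεβ : ε β = B.coeff 0 := hε B
  have hccα : PowerSeries.constantCoeff α = 1 := by
    rw [hα, hcc, reverse, ← reflect_map, hA, hAd]
    simp
  have hccβ : PowerSeries.constantCoeff β = 1 := by rw [hβ, hcc, hB]
  obtain ⟨a, ha⟩ : ∃ a, α * a = 1 := (PowerSeries.isUnit_iff_constantCoeff.2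
    (by rw [hccα]; exact isUnit_one)).exists_right_inv
  obtain ⟨b, hb⟩ : ∃ b, β * b = 1 := (PowerSeries.isUnit_iff_constantCoeff.2
    (by rw [hccβ]; exact isUnit_one)).exists_right_inv
  have hprod : ιn α * ιp β = 1 - PowerSeries.X * PowerSeries.C p := by
    have hT : ∀ n : ℤ, PowerSeries.C (LaurentPolynomial.T n : LaurentPolynomial k) *
        PowerSeries.C (LaurentPolynomial.T (-n)) = 1 := fun n => by
      rw [← map_mul, ← LaurentPolynomial.T_add, add_neg_cancel, LaurentPolynomial.T_zero, map_one]
    have hιp : ∀ q, ιp (Φ q) = eval₂ (PowerSeries.map LaurentPolynomial.C)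
        (PowerSeries.C (LaurentPolynomial.T 1)) q := fun q => by
      simp only [Φ, coe_eval₂RingHom, hom_eval₂]
      congr 1
      · ext x n : 2
        simp [ιp]
      · simp [ιp]
    have hιn : ∀ q, ιn (Φ q) = eval₂ (PowerSeries.map LaurentPolynomial.C)
        (PowerSeries.C (LaurentPolynomial.T (-1))) q := fun q => by
      simp only [Φ, coe_eval₂RingHom, hom_eval₂]
      congr 1
      · ext x n : 2
        simp [ιn]
      · simp [ιn]
    let _ : Invertible (PowerSeries.C (LaurentPolynomial.T 1 : LaurentPolynomial k)) :=
      ⟨PowerSeries.C (LaurentPolynomial.T (-1)), by rw [mul_comm, hT], hT 1⟩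
    have hrev := eval₂_reverse_mul_pow (PowerSeries.map LaurentPolynomial.C)
      (PowerSeries.C (LaurentPolynomial.T 1 : LaurentPolynomial k)) A
    have hrev' : ιn α * PowerSeries.C (LaurentPolynomial.T r) = ιp (Φ A) := by
      rw [hα, hιn, hιp, ← hrev, hAd, ← map_pow, LaurentPolynomial.T_pow, mul_one]
      rfl
    have hG : ιp (Φ A) * ιp β = PowerSeries.C (LaurentPolynomial.T r) -
        PowerSeries.X * PowerSeries.C (toLaurent f) := by
      rw [hβ, ← map_mul, ← map_mul, hAB, map_sub, map_sub]
      congr 1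
      · rw [hιp, eval₂_X_pow, ← map_pow, LaurentPolynomial.T_pow, mul_one]
      · rw [map_mul, map_mul]
        congr 1
        · simp [ιp, Φ]
        · have h1 : (PowerSeries.map C).comp PowerSeries.C =
              (PowerSeries.C : k[X] →+* PowerSeries k[X]).comp C := by
            ext x : 1
            simp
          have h2 : Φ (f.map PowerSeries.C) = PowerSeries.C f := by
            simp only [Φ, coe_eval₂RingHom]
            rw [eval₂_map, h1, ← hom_eval₂, eval₂_C_X]
          rw [h2]
          simp [ιp]
    rw [← hrev'] at hG
    rw [hp, map_mul]
    linear_combination PowerSeries.C (LaurentPolynomial.T (-r)) * hG -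
      (ιn α * ιp β - 1) * hT r
  set U : PowerSeries (LaurentPolynomial k) := PowerSeries.mk fun m => p ^ m with hU
  have hPU : (1 - PowerSeries.X * PowerSeries.C p) * U = 1 := by
    ext1 n
    rw [sub_mul, one_mul, mul_assoc, map_sub]
    cases n with
    | zero => simp [hU]
    | succ n => simp [hU, PowerSeries.coeff_succ_X_mul, pow_succ', PowerSeries.coeff_one]
  have hUab : U = ιn a * ιp b := by
    have h1 : (ιn α * ιp β) * (ιn a * ιp b) = 1 := by
      rw [mul_mul_mul_comm, ← map_mul, ← map_mul, ha, hb, map_one, map_one, mul_one]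
    rw [hprod] at h1
    calc U = U * ((1 - PowerSeries.X * PowerSeries.C p) * (ιn a * ιp b)) := by rw [h1, mul_one]
      _ = _ := by rw [← mul_assoc, mul_comm U, hPU, one_mul]
  have hder : ιn (PowerSeries.derivative _ α * a) + ιp (PowerSeries.derivative _ β * b) =
      - PowerSeries.C p * U := by
    have h1 := congrArg (PowerSeries.derivative (LaurentPolynomial k)) hprod
    rw [Derivation.leibniz, PowerSeries.derivative_map_apply, PowerSeries.derivative_map_apply,
      map_sub, Derivation.leibniz, Derivation.map_one_eq_zero,
      PowerSeries.derivative_X, PowerSeries.derivative_C] at h1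
    simp only [smul_eq_mul] at h1
    have ha' : ιn α * ιn a = 1 := by rw [← map_mul, ha, map_one]
    have hb' : ιp β * ιp b = 1 := by rw [← map_mul, hb, map_one]
    rw [hUab, map_mul, map_mul]
    linear_combination (ιn a * ιp b) * h1 - ιn (PowerSeries.derivative _ α) * ιn a * hb' -
      ιp (PowerSeries.derivative _ β) * ιp b * ha'
  have hder0 : PowerSeries.derivative k (B.coeff 0) = 0 := by
    have h1 : ε (PowerSeries.derivative _ α * a) + ε (PowerSeries.derivative _ β * b) = 0 := by
      ext n
      have h2 := congrArg (fun x => (PowerSeries.coeff n x).coeff 0) hder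
      have h3 : PowerSeries.coeff n (-PowerSeries.C p * U) = -p ^ (n + 1) := by
        rw [neg_mul, map_neg, PowerSeries.coeff_C_mul, hU, PowerSeries.coeff_mk, pow_succ']
      have h4 : ∀ q : k[X], (toLaurent q).coeff 0 = q.coeff 0 := fun q =>
        coeff_toLaurent_natCast q 0
      simp only [h3, map_add, AddMonoidAlgebra.coeff_add, Finsupp.add_apply, ιp, ιn,
        PowerSeries.coeff_map, RingHom.comp_apply, h4, AddMonoidAlgebra.coeff_neg,
        Finsupp.neg_apply, hct (n + 1) (by omega), neg_zero] at h2
      simp only [map_add, PowerSeries.coeff_map, ε, map_zero, constantCoeff_apply]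
      rw [← h2]
      congr 1
      exact (h4 _).symm.trans (by rw [← neg_zero, ← LaurentPolynomial.invert_apply]; rfl)
    rw [map_mul, ← PowerSeries.derivative_map_apply, map_mul, ← PowerSeries.derivative_map_apply]
      at h1
    rw [hεα, hεβ, Derivation.map_one_eq_zero, zero_mul, zero_add] at h1
    have h2 : ε β * ε b = 1 := by rw [← map_mul, hb, map_one]
    calc _ = PowerSeries.derivative k (B.coeff 0) * ε b * ε β := by
          rw [mul_assoc, mul_comm (ε b), h2, mul_one]
      _ = 0 := by rw [h1, zero_mul]
  refine PowerSeries.derivative.ext (by rw [hder0, Derivation.map_one_eq_zero]) ?_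
  rw [← coeff_map, hB]
  simp

section

open LaurentPolynomial

lemma LaurentPolynomial.coeff_T_mul {R : Type*} [Semiring R] (n i : ℤ) (p : R[T;T⁻¹]) :
    (T n * p).coeff i = p.coeff (i - n) := by
  rw [T, AddMonoidAlgebra.coeff_single_mul_eq_mul_coeff (i - n) (by intros; omega), one_mul]

/-- A Laurent polynomial without terms of exponent below `n` is `T n` times a polynomial. -/
lemma LaurentPolynomial.exists_eq_T_mul_toLaurent {R : Type*} [CommSemiring R] {n : ℤ}
    {p : R[T;T⁻¹]} (hp : ∀ i < n, p.coeff i = 0) :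
    ∃ f : Polynomial R, p = T n * Polynomial.toLaurent f := by
  refine ⟨∑ i ∈ p.coeff.support, Polynomial.monomial (i - n).toNat (p.coeff i), ?_⟩
  conv_lhs => rw [← AddMonoidAlgebra.sum_coeff_single p, Finsupp.sum]
  rw [map_sum, Finset.mul_sum]
  refine Finset.sum_congr rfl fun i hi => ?_
  have h : n ≤ i := by
    by_contra! h
    exact Finsupp.mem_support_iff.1 hi (hp i h)
  rw [single_eq_C_mul_T, Polynomial.toLaurent_C_mul_T, Int.toNat_of_nonneg (by omega),
    mul_left_comm, ← T_add, add_sub_cancel]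

/-- One-variable Duistermaat–van der Kallen theorem: if the constant terms of all positive powers
of a Laurent polynomial vanish, then its exponents are all positive or all negative. -/
lemma LaurentPolynomial.coeff_eq_zero_of_coeff_zero_pow_eq_zero {k : Type*} [Field k] [CharZero k]
    {p : k[T;T⁻¹]} (hp : ∀ m : ℕ, 1 ≤ m → (p ^ m).coeff 0 = 0) :
    (∀ i ≤ 0, p.coeff i = 0) ∨ ∀ i, 0 ≤ i → p.coeff i = 0 := by
  by_contra! ⟨⟨i, hi, hpi⟩, j, hj, hpj⟩
  have hp0 : p.coeff 0 = 0 := by simpa using hp 1 le_rfl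
  have hne : p.coeff.support.Nonempty := ⟨i, Finsupp.mem_support_iff.2 hpi⟩
  set n := p.coeff.support.min' hne with hn
  have hpn : p.coeff n ≠ 0 := Finsupp.mem_support_iff.1 (Finset.min'_mem _ hne)
  have hni : n ≤ i := Finset.min'_le _ _ (Finsupp.mem_support_iff.2 hpi)
  have hn0 : n ≠ 0 := by rintro h; exact hpn (h ▸ hp0)
  have hj0 : j ≠ 0 := by rintro rfl; exact hpj hp0
  obtain ⟨f, hf⟩ := exists_eq_T_mul_toLaurent (p := p) (n := n) fun l hl => by
    by_contra h
    exact hl.not_ge (Finset.min'_le _ _ (Finsupp.mem_support_iff.2 h))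
  obtain ⟨r, hr⟩ := Int.exists_eq_neg_ofNat (hni.trans hi)
  have hcoeff : ∀ l : ℕ, f.coeff l = p.coeff (l + n) := fun l => by
    rw [hf, coeff_T_mul, add_sub_cancel_right, coeff_toLaurent_natCast]
  have hf0 : f.coeff 0 ≠ 0 := by rw [hcoeff]; simpa using hpn
  have hfr : r < f.natDegree := by
    have h : f.coeff (j - n).toNat ≠ 0 := by
      rw [hcoeff, Int.toNat_of_nonneg (by omega), sub_add_cancel]
      exact hpj
    have := Polynomial.le_natDegree_of_ne_zero h
    omega
  obtain ⟨A, B, hAm, hAd, hA, hB, hAB⟩ := exists_monic_factor_X_pow_sub r f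
  have hB0 := coeff_zero_cofactor_eq_one hAm hAd hA hB hAB (by rw [← hr, ← hf]; exact hp)
  refine coeff_zero_ne_of_dvd hfr hf0 hAm ⟨B, hAB.symm⟩ ?_
  have h := congrArg (fun q => q.coeff 0) hAB
  rw [Polynomial.mul_coeff_zero, hB0, mul_one] at h
  rw [h, Polynomial.coeff_sub, Polynomial.coeff_X_pow, if_neg (by omega), Polynomial.coeff_C_mul,
    Polynomial.coeff_map, zero_sub]

/-- High powers of a Laurent polynomial with only positive exponents have no low-order terms. -/
lemma LaurentPolynomial.coeff_pow_eq_zero_of_lt {R : Type*} [CommSemiring R] {p : R[T;T⁻¹]}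
    (hp : ∀ i ≤ 0, p.coeff i = 0) {m : ℕ} {i : ℤ} (hi : i < m) : (p ^ m).coeff i = 0 := by
  obtain ⟨f, hf⟩ := exists_eq_T_mul_toLaurent (p := p) (n := 1) fun i hi => hp i (by omega)
  rw [hf, mul_pow, T_pow, ← map_pow, coeff_T_mul]
  exact coeff_toLaurent_of_neg _ (by omega)

/-- If the constant terms of all positive powers of `p` vanish, then every fixed coefficient of
`p ^ m` vanishes for large `m`. -/
lemma LaurentPolynomial.coeff_pow_eq_zero_of_natAbs_lt {k : Type*} [Field k] [CharZero k]
    {p : k[T;T⁻¹]} (hp : ∀ m : ℕ, 1 ≤ m → (p ^ m).coeff 0 = 0) {m : ℕ} {i : ℤ}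
    (hi : i.natAbs < m) : (p ^ m).coeff i = 0 := by
  rcases coeff_eq_zero_of_coeff_zero_pow_eq_zero hp with h | h
  · exact coeff_pow_eq_zero_of_lt h (by omega)
  · rw [← neg_neg i, ← invert_apply, map_pow]
    refine coeff_pow_eq_zero_of_lt (fun j hj => ?_) (by omega)
    rw [invert_apply]
    exact h _ (by omega)

open ComplexConjugate in
/-- Angular moments vanish by rotation invariance. -/
lemma integral_pow_mul_conj_pow_eq_zero {a b : ℕ} (hab : a ≠ b) :
    ∫ z, z ^ a * conj z ^ b ∂(stdGaussian ℂ) = 0 := by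
  set I := ∫ z, z ^ a * conj z ^ b ∂(stdGaussian ℂ) with hI
  have h : ∀ c : Circle, I = (c : ℂ) ^ a * conj (c : ℂ) ^ b * I := by
    intro c
    rw [hI, ← integral_const_mul]
    conv_lhs => rw [← stdGaussian_map (rotation c)]
    rw [integral_map (by fun_prop) (by fun_prop)]
    congr 1 with z
    simp [mul_pow]
    ring
  have hab' : (a : ℂ) - b ≠ 0 := sub_ne_zero.2 (by exact_mod_cast hab)
  have hc := h (Circle.exp (Real.pi / (a - b)))
  have hexp : (Circle.exp (Real.pi / (a - b)) : ℂ) ^ a *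
      conj (Circle.exp (Real.pi / (a - b)) : ℂ) ^ b = -1 := by
    rw [Circle.coe_exp, ← Complex.exp_conj, ← Complex.exp_nat_mul, ← Complex.exp_nat_mul,
      ← Complex.exp_add, ← Complex.exp_pi_mul_I]
    congr 1
    simp
    field_simp
    ring
  rw [hexp] at hc
  linear_combination hc / 2

open ComplexConjugate in
lemma integrable_pow_mul_conj_pow (a b : ℕ) :
    Integrable (fun z : ℂ => z ^ a * conj z ^ b) (stdGaussian ℂ) := by
  have h := (IsGaussian.memLp_id (stdGaussian ℂ) (a + b : ℕ) (by simp)).integrable_norm_pow'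
  refine h.mono' (by fun_prop) ?_
  filter_upwards with z
  simp [pow_add]

open ComplexConjugate in
lemma integral_pow_mul_conj_pow_ne_zero (a : ℕ) :
    ∫ z, z ^ a * conj z ^ a ∂(stdGaussian ℂ) ≠ 0 := by
  have h1 : ∀ z : ℂ, z ^ a * conj z ^ a = ((‖z‖ ^ (2 * a) : ℝ) : ℂ) := fun z => by
    rw [← mul_pow, Complex.mul_conj']; push_cast; rw [pow_mul]
  have hintegral : Integrable (fun z : ℂ => ‖z‖ ^ (2 * a)) (stdGaussian ℂ) := by
    have := (integrable_pow_mul_conj_pow a a).norm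
    simpa [pow_mul, two_mul, pow_add] using this
  simp_rw [h1]
  rw [integral_complex_ofReal]
  norm_cast
  intro h0
  rw [integral_eq_zero_iff_of_nonneg (fun z => by positivity) hintegral] at h0
  have hz : (fun z : ℂ => Complex.exp (((inner ℝ z 1 : ℝ) : ℂ) * Complex.I)) =ᵐ[stdGaussian ℂ]
      fun _ => 1 := by
    filter_upwards [h0] with z hz
    have : z = 0 := by
      rw [← norm_eq_zero]
      exact eq_zero_of_pow_eq_zero hz
    simp [this]
  have h2 := charFun_stdGaussian (1 : ℂ)
  rw [charFun_apply, integral_congr_ae hz] at h2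
  simp at h2
  have h3 := congrArg norm h2
  rw [Complex.norm_exp, norm_one] at h3
  exact h3.not_gt (Real.exp_lt_one_iff.2 (by norm_num))

/-- The Gaussian expectation in complex coordinates. -/
lemma integral_pi_eq_integral_stdGaussian_complex (g : ℂ → ℂ) (hg : Continuous g) :
    ∫ x : Fin 2 → ℝ, g (x 0 + x 1 * Complex.I) ∂(Measure.pi fun _ => gaussianReal 0 1) =
      ∫ z, g z ∂(stdGaussian ℂ) := by
  rw [stdGaussian_eq_map_pi_orthonormalBasis Complex.orthonormalBasisOneI,
    integral_map (Continuous.aemeasurable (by fun_prop)) hg.aestronglyMeasurable]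
  simp

open ComplexConjugate in
lemma integrable_eval_conj (F : MvPolynomial (Fin 2) ℂ) :
    Integrable (fun z : ℂ => MvPolynomial.eval ![z, conj z] F) (stdGaussian ℂ) := by
  induction F using MvPolynomial.induction_on' with
  | monomial s c =>
    simpa [MvPolynomial.eval_monomial] using (integrable_pow_mul_conj_pow (s 0) (s 1)).const_mul c
  | add p q hp hq =>
    simp only [map_add]
    exact hp.add hq

open ComplexConjugate in
/-- The Gaussian expectation of a polynomial in `z` and `conj z`. -/
noncomputable def conjGaussExp : MvPolynomial (Fin 2) ℂ →ₗ[ℂ] ℂ where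
  toFun F := ∫ z, MvPolynomial.eval ![z, conj z] F ∂(stdGaussian ℂ)
  map_add' F G := by
    simp only [map_add]
    exact integral_add (integrable_eval_conj F) (integrable_eval_conj G)
  map_smul' c F := by
    simp only [MvPolynomial.smul_eval, RingHom.id_apply, smul_eq_mul]
    exact integral_const_mul _ _

open ComplexConjugate in
lemma conjGaussExp_monomial (s : Fin 2 →₀ ℕ) (c : ℂ) :
    conjGaussExp (MvPolynomial.monomial s c) =
      c * ∫ z, z ^ s 0 * conj z ^ s 1 ∂(stdGaussian ℂ) := by
  simp [conjGaussExp, MvPolynomial.eval_monomial, integral_const_mul]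

/-- Restriction of a polynomial in `z` and `conj z` to the unit circle. -/
noncomputable def toCircle : MvPolynomial (Fin 2) ℂ →ₐ[ℂ] ℂ[T;T⁻¹] :=
  MvPolynomial.aeval ![T 1, T (-1)]

lemma toCircle_monomial (s : Fin 2 →₀ ℕ) (c : ℂ) :
    toCircle (MvPolynomial.monomial s c) =
      AddMonoidAlgebra.single ((s 0 : ℤ) - s 1) c := by
  rw [toCircle, MvPolynomial.aeval_monomial, single_eq_C_mul_T,
    Finsupp.prod_fintype _ _ fun i => pow_zero _, Fin.prod_univ_two]
  simp only [Matrix.cons_val_zero, Matrix.cons_val_one, T_pow]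
  rw [← T_add, mul_one, mul_neg_one, ← sub_eq_add_neg]
  rfl

/-- The Gaussian expectation of a homogeneous polynomial is a nonzero multiple of its average
over the unit circle. -/
lemma conjGaussExp_eq_zero_iff {F : MvPolynomial (Fin 2) ℂ} {d : ℕ} (hF : F.IsHomogeneous d) :
    conjGaussExp F = 0 ↔ (toCircle F).coeff 0 = 0 := by
  set K := ∫ z, z ^ (d / 2) * (starRingEnd ℂ) z ^ (d / 2) ∂(stdGaussian ℂ) with hK
  have h : conjGaussExp F = K * (toCircle F).coeff 0 := by
    rw [F.as_sum, map_sum, map_sum, AddMonoidAlgebra.coeff_sum, Finsupp.finsetSum_apply,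
      Finset.mul_sum]
    refine Finset.sum_congr rfl fun s hs => ?_
    have hd : s 0 + s 1 = d := by
      have := hF (MvPolynomial.mem_support_iff.1 hs)
      simpa [Finsupp.weight_apply, Finsupp.sum_fintype] using this
    rw [conjGaussExp_monomial, toCircle_monomial, AddMonoidAlgebra.coeff_single]
    by_cases h01 : s 0 = s 1
    · rw [h01, sub_self, Finsupp.single_eq_same, hK, show d / 2 = s 1 by omega, mul_comm]
    · rw [integral_pow_mul_conj_pow_eq_zero h01, Finsupp.single_eq_of_ne (by omega), mul_zero,
        mul_zero]
  rw [h, mul_eq_zero, or_iff_right (integral_pow_mul_conj_pow_ne_zero _)]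

/-- The substitution `x = (z + conj z) / 2`, `y = (z - conj z) / (2 i)`. -/
noncomputable def toConjCoords : MvPolynomial (Fin 2) ℂ →ₐ[ℂ] MvPolynomial (Fin 2) ℂ :=
  MvPolynomial.aeval ![MvPolynomial.C (1 / 2) * (MvPolynomial.X 0 + MvPolynomial.X 1),
    MvPolynomial.C (-Complex.I / 2) * (MvPolynomial.X 0 - MvPolynomial.X 1)]

lemma MvPolynomial.IsHomogeneous.map_toConjCoords {P : MvPolynomial (Fin 2) ℂ} {d : ℕ}
    (hP : P.IsHomogeneous d) : (toConjCoords P).IsHomogeneous d := by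
  rw [← one_mul d]
  refine hP.aeval _ fun i => ?_
  fin_cases i
  · exact ((isHomogeneous_X ℂ 0).add (isHomogeneous_X ℂ 1)).C_mul _
  · exact ((isHomogeneous_X ℂ 0).sub (isHomogeneous_X ℂ 1)).C_mul _

lemma gaussExp_eq_conjGaussExp (P : MvPolynomial (Fin 2) ℂ) :
    gaussExp P = conjGaussExp (toConjCoords P) := by
  have hcont : Continuous fun z : ℂ =>
      MvPolynomial.eval ![z, (starRingEnd ℂ) z] (toConjCoords P) :=
    (MvPolynomial.continuous_eval _).comp (by fun_prop)
  refine Eq.trans ?_ (integral_pi_eq_integral_stdGaussian_complex _ hcont)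
  refine integral_congr_ae (.of_forall fun x => ?_)
  have h : (MvPolynomial.eval ![(x 0 : ℂ) + x 1 * Complex.I,
      (starRingEnd ℂ) (x 0 + x 1 * Complex.I)]).comp (toConjCoords : _ →+* _) =
      MvPolynomial.eval fun i => (x i : ℂ) := by
    refine MvPolynomial.ringHom_ext (fun c => by simp [toConjCoords]) fun i => ?_
    fin_cases i
    · simp [toConjCoords]
      ring
    · simp [toConjCoords]
      linear_combination (-(x 1 : ℂ)) * Complex.I_mul_I
  exact congrArg (fun g : MvPolynomial (Fin 2) ℂ →+* ℂ => g P) h.symm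

end

/-- `GMC(2)` holds for homogeneous polynomials in two variables. -/
theorem gmc2_for_homogeneous (P : MvPolynomial (Fin 2) ℂ)
    (hhom : ∃ d : ℕ, P.IsHomogeneous d)
    (hP : ∀ m : ℕ, 1 ≤ m → gaussExp (P ^ m) = 0) :
    ∀ Q : MvPolynomial (Fin 2) ℂ, ∃ N : ℕ, ∀ m : ℕ, N ≤ m →
      gaussExp (P ^ m * Q) = 0 := by
  intro Q
  obtain ⟨d, hd⟩ := hhom
  have hH := hd.map_toConjCoords
  simp only [gaussExp_eq_conjGaussExp, map_mul, map_pow] at hP ⊢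
  generalize toConjCoords P = H at hP hH
  have hp : ∀ m : ℕ, 1 ≤ m → (toCircle H ^ m).coeff 0 = 0 := fun m hm => by
    rw [← map_pow, ← conjGaussExp_eq_zero_iff (hH.pow m)]
    exact hP m hm
  induction toConjCoords Q using MvPolynomial.induction_on' with
  | monomial s c =>
    refine ⟨((s 0 : ℤ) - s 1).natAbs + 1, fun m hm => ?_⟩
    rw [conjGaussExp_eq_zero_iff ((hH.pow m).mul (MvPolynomial.isHomogeneous_monomial c rfl)),
      map_mul, map_pow, toCircle_monomial, AddMonoidAlgebra.coeff_mul_single_eq_coeff_mul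
        (-((s 0 : ℤ) - s 1)) (by intros; omega),
      LaurentPolynomial.coeff_pow_eq_zero_of_natAbs_lt hp (by omega), zero_mul]
  | add F G hF hG =>
    obtain ⟨M, hM⟩ := hF
    obtain ⟨N, hN⟩ := hG
    refine ⟨max M N, fun m hm => ?_⟩
    rw [mul_add, map_add, hM m (by omega), hN m (by omega), add_zero]
end
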